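/- arXiv:1708.02514 — 2 statements merged into one kernel-verified Lean document; each statement's English description precedes it below -/
import Mathlib

section
/- Let A and B be one-generated graded 𝕜-algebras and let n be a positive integer. Suppose t: (B⊗A)_{≤n+1} → (A⊗B)_{≤n+1} is a graded 𝕜-linear map satisfying the unital conditions t(1⊗a)=a⊗1 and t(b⊗1)=1⊗b, such that: (1) the restriction of t to (B⊗A)_{≤n} is graded twisting to degree n; (2) t(1_B⊗μ_A) = (μ_A⊗1_B)(1_A⊗t)(t⊗1_A) on (B⊗A⊗A₁)_{n+1}; and (3) t(μ_B⊗1_A) = (1_A⊗μ_B)(t⊗1_B)(1_B⊗t) on (B₁⊗B⊗A)_{n+1}. Then t is graded twisting to degree n+1. -/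
open TensorProduct

noncomputable section

namespace TTP

variable (𝕜 : Type) [Field 𝕜]

/-- The image of `p ⊗ q` inside `M ⊗[𝕜] N`, for submodules `p ⊆ M`, `q ⊆ N`. -/
def subTmul {M N : Type} [AddCommGroup M] [Module 𝕜 M] [AddCommGroup N] [Module 𝕜 N]
    (p : Submodule 𝕜 M) (q : Submodule 𝕜 N) : Submodule 𝕜 (M ⊗[𝕜] N) :=
  LinearMap.range (TensorProduct.map p.subtype q.subtype)

/-- The Künneth grading on a tensor product of graded vector spaces. -/
def kunneth {M N : Type} [AddCommGroup M] [Module 𝕜 M] [AddCommGroup N] [Module 𝕜 N]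
    (𝒜 : ℕ → Submodule 𝕜 M) (ℬ : ℕ → Submodule 𝕜 N) (n : ℕ) : Submodule 𝕜 (M ⊗[𝕜] N) :=
  ⨆ (pq : ℕ × ℕ) (_ : pq.1 + pq.2 = n), subTmul 𝕜 (𝒜 pq.1) (ℬ pq.2)

/-- The positive part `X₊ = ⊕_{i>0} X_i` of a graded vector space. -/
def plusPart {M : Type} [AddCommGroup M] [Module 𝕜 M] (𝒜 : ℕ → Submodule 𝕜 M) :
    Submodule 𝕜 M :=
  ⨆ (i : ℕ) (_ : 0 < i), 𝒜 i

/-- The grading concentrating `𝒜 1` in degree `1` (and `⊥` elsewhere). -/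
def degOne {M : Type} [AddCommGroup M] [Module 𝕜 M] (𝒜 : ℕ → Submodule 𝕜 M) :
    ℕ → Submodule 𝕜 M :=
  fun n => if n = 1 then 𝒜 1 else ⊥

variable (A B : Type) [Ring A] [Algebra 𝕜 A] [Ring B] [Algebra 𝕜 B]

/-- `τ ∘ (μ_B ⊗ μ_A)` on `(B ⊗ B) ⊗ (A ⊗ A)`. -/
def twistLHS (τ : B ⊗[𝕜] A →ₗ[𝕜] A ⊗[𝕜] B) :
    (B ⊗[𝕜] B) ⊗[𝕜] (A ⊗[𝕜] A) →ₗ[𝕜] A ⊗[𝕜] B :=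
  τ ∘ₗ TensorProduct.map (LinearMap.mul' 𝕜 B) (LinearMap.mul' 𝕜 A)

/-- `(μ_A ⊗ μ_B) ∘ (1_A ⊗ τ ⊗ 1_B) ∘ (τ ⊗ τ) ∘ (1_B ⊗ τ ⊗ 1_A)` on `(B ⊗ B) ⊗ (A ⊗ A)`. -/
def twistRHS (τ : B ⊗[𝕜] A →ₗ[𝕜] A ⊗[𝕜] B) :
    (B ⊗[𝕜] B) ⊗[𝕜] (A ⊗[𝕜] A) →ₗ[𝕜] A ⊗[𝕜] B :=
  TensorProduct.map (LinearMap.mul' 𝕜 A) (LinearMap.mul' 𝕜 B)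
    ∘ₗ (TensorProduct.assoc 𝕜 A A (B ⊗[𝕜] B)).symm.toLinearMap
    ∘ₗ LinearMap.lTensor A (TensorProduct.assoc 𝕜 A B B).toLinearMap
    ∘ₗ LinearMap.lTensor A (LinearMap.rTensor B τ)
    ∘ₗ LinearMap.lTensor A (TensorProduct.assoc 𝕜 B A B).symm.toLinearMap
    ∘ₗ (TensorProduct.assoc 𝕜 A B (A ⊗[𝕜] B)).toLinearMap
    ∘ₗ TensorProduct.map τ τ
    ∘ₗ (TensorProduct.assoc 𝕜 B A (B ⊗[𝕜] A)).symm.toLinearMap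
    ∘ₗ LinearMap.lTensor B (TensorProduct.assoc 𝕜 A B A).toLinearMap
    ∘ₗ LinearMap.lTensor B (LinearMap.rTensor A τ)
    ∘ₗ LinearMap.lTensor B (TensorProduct.assoc 𝕜 B A A).symm.toLinearMap
    ∘ₗ (TensorProduct.assoc 𝕜 B B (A ⊗[𝕜] A)).toLinearMap

/-- `τ : B ⊗ A → A ⊗ B` is an (algebra) twisting map: it satisfies the unital twisting
conditions and `τ(μ_B ⊗ μ_A) = (μ_A ⊗ μ_B)(1_A ⊗ τ ⊗ 1_B)(τ ⊗ τ)(1_B ⊗ τ ⊗ 1_A)`. -/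
def IsTwisting (τ : B ⊗[𝕜] A →ₗ[𝕜] A ⊗[𝕜] B) : Prop :=
  (∀ a : A, τ ((1 : B) ⊗ₜ[𝕜] a) = a ⊗ₜ[𝕜] (1 : B)) ∧
  (∀ b : B, τ (b ⊗ₜ[𝕜] (1 : A)) = (1 : A) ⊗ₜ[𝕜] b) ∧
  twistLHS 𝕜 A B τ = twistRHS 𝕜 A B τ

/-- `τ` preserves the Künneth grading. -/
def IsGradedMapBA (𝒜 : ℕ → Submodule 𝕜 A) (ℬ : ℕ → Submodule 𝕜 B)
    (τ : B ⊗[𝕜] A →ₗ[𝕜] A ⊗[𝕜] B) : Prop :=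
  ∀ n, Submodule.map τ (kunneth 𝕜 ℬ 𝒜 n) ≤ kunneth 𝕜 𝒜 ℬ n

/-- `τ` is a graded twisting map. -/
def IsGradedTwisting (𝒜 : ℕ → Submodule 𝕜 A) (ℬ : ℕ → Submodule 𝕜 B)
    (τ : B ⊗[𝕜] A →ₗ[𝕜] A ⊗[𝕜] B) : Prop :=
  IsTwisting 𝕜 A B τ ∧ IsGradedMapBA 𝕜 A B 𝒜 ℬ τ

/-- A graded linear map `τ` is graded twisting to degree `n`:  it satisfies the unital
conditions and the twisting identity in all (Künneth) degrees `≤ n`. -/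
def TwistingToDeg (𝒜 : ℕ → Submodule 𝕜 A) (ℬ : ℕ → Submodule 𝕜 B)
    (τ : B ⊗[𝕜] A →ₗ[𝕜] A ⊗[𝕜] B) (n : ℕ) : Prop :=
  IsGradedMapBA 𝕜 A B 𝒜 ℬ τ ∧
  (∀ j ≤ n, ∀ a ∈ 𝒜 j, τ ((1 : B) ⊗ₜ[𝕜] a) = a ⊗ₜ[𝕜] (1 : B)) ∧
  (∀ j ≤ n, ∀ b ∈ ℬ j, τ (b ⊗ₜ[𝕜] (1 : A)) = (1 : A) ⊗ₜ[𝕜] b) ∧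
  (∀ j ≤ n, ∀ x ∈ kunneth 𝕜 (kunneth 𝕜 ℬ ℬ) (kunneth 𝕜 𝒜 𝒜) j,
    twistLHS 𝕜 A B τ x = twistRHS 𝕜 A B τ x)

/-- The unique extension property of a graded twisting map:  for every `n ≥ 3`, any
linear map `τ'` that is graded twisting to degree `n` and agrees with `τ` in all degrees
`< n` also agrees with `τ` in degree `n`. -/
def UEP (𝒜 : ℕ → Submodule 𝕜 A) (ℬ : ℕ → Submodule 𝕜 B)
    (τ : B ⊗[𝕜] A →ₗ[𝕜] A ⊗[𝕜] B) : Prop :=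
  ∀ n, 3 ≤ n → ∀ τ' : B ⊗[𝕜] A →ₗ[𝕜] A ⊗[𝕜] B,
    TwistingToDeg 𝕜 A B 𝒜 ℬ τ' n →
    (∀ i < n, ∀ x ∈ kunneth 𝕜 ℬ 𝒜 i, τ' x = τ x) →
    ∀ x ∈ kunneth 𝕜 ℬ 𝒜 n, τ' x = τ x

/-- The multiplication `μ_τ = (μ_A ⊗ μ_B)(1_A ⊗ τ ⊗ 1_B)` on `A ⊗ B`. -/
def mulTau (τ : B ⊗[𝕜] A →ₗ[𝕜] A ⊗[𝕜] B) :
    (A ⊗[𝕜] B) ⊗[𝕜] (A ⊗[𝕜] B) →ₗ[𝕜] A ⊗[𝕜] B :=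
  TensorProduct.map (LinearMap.mul' 𝕜 A) (LinearMap.mul' 𝕜 B)
    ∘ₗ (TensorProduct.assoc 𝕜 A A (B ⊗[𝕜] B)).symm.toLinearMap
    ∘ₗ LinearMap.lTensor A (TensorProduct.assoc 𝕜 A B B).toLinearMap
    ∘ₗ LinearMap.lTensor A (LinearMap.rTensor B τ)
    ∘ₗ LinearMap.lTensor A (TensorProduct.assoc 𝕜 B A B).symm.toLinearMap
    ∘ₗ (TensorProduct.assoc 𝕜 A B (A ⊗[𝕜] B)).toLinearMap

/-- `(C, ψ)` realizes the twisted tensor product algebra `A ⊗_τ B`:  `ψ` is a linear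
isomorphism carrying the multiplication `μ_τ` and its unit to those of `C`. -/
def Realizes (τ : B ⊗[𝕜] A →ₗ[𝕜] A ⊗[𝕜] B) (C : Type) [Ring C] [Algebra 𝕜 C]
    (ψ : A ⊗[𝕜] B →ₗ[𝕜] C) : Prop :=
  Function.Bijective ψ ∧ ψ ((1 : A) ⊗ₜ[𝕜] (1 : B)) = 1 ∧
  ∀ x y : A ⊗[𝕜] B, ψ (mulTau 𝕜 A B τ (x ⊗ₜ[𝕜] y)) = ψ x * ψ y

/-- The two-sided ideal generated by a subset, as a `𝕜`-submodule. -/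
def idealSpan (C : Type) [Ring C] [Algebra 𝕜 C] (s : Set C) : Submodule 𝕜 C :=
  Submodule.span 𝕜 {x | ∃ c d r, r ∈ s ∧ x = c * r * d}

/-- Weight grading of the tensor algebra. -/
def tensorWeight (V : Type) [AddCommGroup V] [Module 𝕜 V] (n : ℕ) :
    Submodule 𝕜 (TensorAlgebra 𝕜 V) :=
  LinearMap.range (TensorAlgebra.ι 𝕜 (M := V)) ^ n

instance (V : Type) [AddCommGroup V] [Module 𝕜 V] : GradedAlgebra (tensorWeight 𝕜 V) :=
  inferInstanceAs (GradedAlgebra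
    ((LinearMap.range (TensorAlgebra.ι 𝕜 : V →ₗ[𝕜] TensorAlgebra 𝕜 V) ^ ·) : ℕ → Submodule 𝕜 _))

/-- The canonical map `T(C₁) → C` for a graded algebra `C`. -/
def canMap (C : Type) [Ring C] [Algebra 𝕜 C] (𝒞 : ℕ → Submodule 𝕜 C) :
    TensorAlgebra 𝕜 ↥(𝒞 1) →ₐ[𝕜] C :=
  TensorAlgebra.lift 𝕜 (𝒞 1).subtype

/-- `C` (with grading `𝒞`) is a quadratic algebra: the canonical map `T(C₁) → C` is
surjective and its kernel is generated, as a two-sided ideal, by its degree 2 part. -/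
def IsQuadraticAlg (C : Type) [Ring C] [Algebra 𝕜 C] (𝒞 : ℕ → Submodule 𝕜 C) : Prop :=
  Function.Surjective (canMap 𝕜 C 𝒞) ∧
  LinearMap.ker (canMap 𝕜 C 𝒞).toLinearMap =
    idealSpan 𝕜 (TensorAlgebra 𝕜 ↥(𝒞 1))
      ((LinearMap.ker (canMap 𝕜 C 𝒞).toLinearMap ⊓ tensorWeight 𝕜 ↥(𝒞 1) 2 : Submodule 𝕜 _) : Set _)

/-- The left ideal generated by the positive part of a graded algebra. -/
def augIdeal (C : Type) [Ring C] [Algebra 𝕜 C] (𝒞 : ℕ → Submodule 𝕜 C) : Submodule C C :=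
  Submodule.span C {x : C | ∃ i, 0 < i ∧ x ∈ 𝒞 i}

/-- The degree `n` component of the graded free module on generators `σ` in degree `i`. -/
def freeGrade (C : Type) [Ring C] [Algebra 𝕜 C] (𝒞 : ℕ → Submodule 𝕜 C)
    (i : ℕ) (σ : Type) (n : ℕ) : Submodule 𝕜 (σ →₀ C) :=
  ⨅ (j : σ), Submodule.comap (Finsupp.lapply j : (σ →₀ C) →ₗ[𝕜] C)
    (if i ≤ n then 𝒞 (n - i) else ⊥)

/-- `C` (with grading `𝒞`) is a Koszul algebra: the trivial module `𝕜 = C/C₊` admits a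
resolution by graded free modules with the `i`-th term generated in degree `i`. -/
def IsKoszul (C : Type) [Ring C] [Algebra 𝕜 C] (𝒞 : ℕ → Submodule 𝕜 C) : Prop :=
  ∃ (σ : ℕ → Type) (d : ∀ i : ℕ, ((σ (i + 1)) →₀ C) →ₗ[C] ((σ i) →₀ C))
    (ε : ((σ 0) →₀ C) →ₗ[C] (C ⧸ augIdeal 𝕜 C 𝒞)),
    Function.Surjective ε ∧
    LinearMap.ker ε = LinearMap.range (d 0) ∧
    (∀ i, LinearMap.ker (d i) = LinearMap.range (d (i + 1))) ∧
    (∀ i n, ∀ x ∈ freeGrade 𝕜 C 𝒞 (i + 1) (σ (i + 1)) n, d i x ∈ freeGrade 𝕜 C 𝒞 i (σ i) n) ∧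
    (∀ n, 0 < n → ∀ x ∈ freeGrade 𝕜 C 𝒞 0 (σ 0) n, ε x = 0)

/-- `(P, ιA, ιB)` is a free product (coproduct) of `A` and `B`. -/
def IsFreeProduct (P : Type) [Ring P] [Algebra 𝕜 P] (ιA : A →ₐ[𝕜] P) (ιB : B →ₐ[𝕜] P) :
    Prop :=
  ∀ (C : Type) [Ring C] [Algebra 𝕜 C], ∀ (f : A →ₐ[𝕜] C) (g : B →ₐ[𝕜] C),
    ∃! h : P →ₐ[𝕜] C, h.comp ιA = f ∧ h.comp ιB = g

/-- The linear map `A ⊗ B → P`, `a ⊗ b ↦ ιA(a) · ιB(b)`. -/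
def mulMapP (P : Type) [Ring P] [Algebra 𝕜 P] (ιA : A →ₐ[𝕜] P) (ιB : B →ₐ[𝕜] P) :
    A ⊗[𝕜] B →ₗ[𝕜] P :=
  TensorProduct.lift (LinearMap.mk₂ 𝕜 (fun a b => ιA a * ιB b)
    (fun a a' b => by simp [map_add, add_mul])
    (fun c a b => by simp [map_smul, smul_mul_assoc])
    (fun a b b' => by simp [map_add, mul_add])
    (fun c a b => by simp [map_smul, mul_smul_comm]))

/-- The set of `τ`-relations `b ⊗ a - τ(b ⊗ a)` of total degree at most `n`,
inside the free product `P`. -/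
def relSetLe (P : Type) [Ring P] [Algebra 𝕜 P] (ιA : A →ₐ[𝕜] P) (ιB : B →ₐ[𝕜] P)
    (𝒜 : ℕ → Submodule 𝕜 A) (ℬ : ℕ → Submodule 𝕜 B)
    (τ : B ⊗[𝕜] A →ₗ[𝕜] A ⊗[𝕜] B) (n : ℕ) : Set P :=
  {x | ∃ i j a b, i + j ≤ n ∧ a ∈ 𝒜 i ∧ b ∈ ℬ j ∧
    x = ιB b * ιA a - mulMapP 𝕜 A B P ιA ιB (τ (b ⊗ₜ[𝕜] a))}

/-- The set of all `τ`-relations `b ⊗ a - τ(b ⊗ a)` inside the free product `P`. -/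
def relSetAll (P : Type) [Ring P] [Algebra 𝕜 P] (ιA : A →ₐ[𝕜] P) (ιB : B →ₐ[𝕜] P)
    (τ : B ⊗[𝕜] A →ₗ[𝕜] A ⊗[𝕜] B) : Set P :=
  {x | ∃ a b, x = ιB b * ιA a - mulMapP 𝕜 A B P ιA ιB (τ (b ⊗ₜ[𝕜] a))}

/-- The (Künneth) grading on the free product `P` of the graded algebras `A` and `B`. -/
def freeProdGrade (P : Type) [Ring P] [Algebra 𝕜 P] (ιA : A →ₐ[𝕜] P) (ιB : B →ₐ[𝕜] P)
    (𝒜 : ℕ → Submodule 𝕜 A) (ℬ : ℕ → Submodule 𝕜 B) (n : ℕ) : Submodule 𝕜 P :=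
  ⨆ (l : List ℕ) (_ : l.sum = n),
    ((l.map (fun i => Submodule.map ιA.toLinearMap (𝒜 i) ⊔ Submodule.map ιB.toLinearMap (ℬ i))).foldr
      (· * ·) 1)

end TTP

namespace TTP

open TensorProduct LinearMap

section Kunneth

variable {𝕜 : Type} [Field 𝕜] {M N P : Type} [AddCommGroup M] [Module 𝕜 M]
  [AddCommGroup N] [Module 𝕜 N] [AddCommGroup P] [Module 𝕜 P]
  {𝒜 : ℕ → Submodule 𝕜 M} {ℬ : ℕ → Submodule 𝕜 N}

theorem tmul_mem_kunneth {i j m : ℕ} (h : i + j = m) {a : M} (ha : a ∈ 𝒜 i) {b : N}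
    (hb : b ∈ ℬ j) : a ⊗ₜ[𝕜] b ∈ kunneth 𝕜 𝒜 ℬ m :=
  Submodule.mem_iSup_of_mem (i, j) <| Submodule.mem_iSup_of_mem h
    ⟨(⟨a, ha⟩ : 𝒜 i) ⊗ₜ[𝕜] (⟨b, hb⟩ : ℬ j), by simp⟩

/-- Linear maps agreeing on homogeneous pure tensors of total degree `m` agree on the degree `m`
part of the Künneth grading. -/
theorem kunneth_eqOn {m : ℕ} {f g : M ⊗[𝕜] N →ₗ[𝕜] P}
    (h : ∀ i j, i + j = m → ∀ a ∈ 𝒜 i, ∀ b ∈ ℬ j, f (a ⊗ₜ b) = g (a ⊗ₜ b))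
    {x : M ⊗[𝕜] N} (hx : x ∈ kunneth 𝕜 𝒜 ℬ m) : f x = g x := by
  suffices kunneth 𝕜 𝒜 ℬ m ≤ LinearMap.eqLocus f g from this hx
  refine iSup₂_le fun ij hij => ?_
  rintro _ ⟨y, rfl⟩
  induction y with
  | zero => simp
  | tmul a b => exact h ij.1 ij.2 hij a a.2 b b.2
  | add y z hy hz =>
    rw [map_add]
    exact Submodule.add_mem _ hy hz

theorem kunneth_degOne_right_mem {i m : ℕ} (h : i + 1 = m) {a : M} (ha : a ∈ 𝒜 i) {b : N}
    (hb : b ∈ ℬ 1) : a ⊗ₜ[𝕜] b ∈ kunneth 𝕜 𝒜 (degOne 𝕜 ℬ) m :=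
  tmul_mem_kunneth h ha (by simpa [degOne] using hb)

theorem kunneth_degOne_left_mem {j m : ℕ} (h : 1 + j = m) {a : M} (ha : a ∈ 𝒜 1) {b : N}
    (hb : b ∈ ℬ j) : a ⊗ₜ[𝕜] b ∈ kunneth 𝕜 (degOne 𝕜 𝒜) ℬ m :=
  tmul_mem_kunneth h (by simpa [degOne] using ha) hb

end Kunneth

section OneGenerated

variable {𝕜 : Type} [Field 𝕜] {A : Type} [Ring A] [Algebra 𝕜 A] {𝒜 : ℕ → Submodule 𝕜 A}

theorem grade_succ_eq_mul_grade_one (h0 : 𝒜 0 = 1) (h : ∀ m : ℕ, 1 ≤ m → 𝒜 m = 𝒜 1 ^ m)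
    (m : ℕ) : 𝒜 (m + 1) = 𝒜 m * 𝒜 1 := by
  rcases Nat.eq_zero_or_pos m with rfl | hm
  · rw [h0, one_mul]
  · rw [h (m + 1) (by omega), h m hm, pow_succ]

theorem grade_succ_eq_grade_one_mul (h0 : 𝒜 0 = 1) (h : ∀ m : ℕ, 1 ≤ m → 𝒜 m = 𝒜 1 ^ m)
    (m : ℕ) : 𝒜 (m + 1) = 𝒜 1 * 𝒜 m := by
  rcases Nat.eq_zero_or_pos m with rfl | hm
  · rw [h0, mul_one]
  · rw [h (m + 1) (by omega), h m hm, pow_succ']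

end OneGenerated

section Actions

variable {𝕜 : Type} [Field 𝕜] {A B : Type} [Ring A] [Algebra 𝕜 A] [Ring B] [Algebra 𝕜 B]
  (t : B ⊗[𝕜] A →ₗ[𝕜] A ⊗[𝕜] B)

/-- Right multiplication by `a` on `A ⊗ B` twisted by `t`: the map
`a₁ ⊗ b₁ ↦ (μ_A ⊗ 1)(a₁ ⊗ t(b₁ ⊗ a))`. -/
def rightTwist (a : A) : A ⊗[𝕜] B →ₗ[𝕜] A ⊗[𝕜] B :=
  rTensor B (mul' 𝕜 A) ∘ₗ (TensorProduct.assoc 𝕜 A A B).symm.toLinearMap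
    ∘ₗ lTensor A (t ∘ₗ (TensorProduct.mk 𝕜 B A).flip a)

/-- Left multiplication by `b` on `A ⊗ B` twisted by `t`: the map
`a₁ ⊗ b₁ ↦ (1 ⊗ μ_B)(t(b ⊗ a₁) ⊗ b₁)`. -/
def leftTwist (b : B) : A ⊗[𝕜] B →ₗ[𝕜] A ⊗[𝕜] B :=
  lTensor A (mul' 𝕜 B) ∘ₗ (TensorProduct.assoc 𝕜 A B B).toLinearMap
    ∘ₗ rTensor B (t ∘ₗ TensorProduct.mk 𝕜 B A b)

theorem rTensor_mul'_assoc_symm_tmul (a : A) (x : A ⊗[𝕜] B) :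
    rTensor B (mul' 𝕜 A) ((TensorProduct.assoc 𝕜 A A B).symm (a ⊗ₜ x)) =
      rTensor B (mulLeft 𝕜 a) x := by
  induction x with
  | zero => simp
  | tmul => simp
  | add x y hx hy => simp only [TensorProduct.tmul_add, map_add, hx, hy]

theorem lTensor_mul'_assoc_tmul (b : B) (x : A ⊗[𝕜] B) :
    lTensor A (mul' 𝕜 B) (TensorProduct.assoc 𝕜 A B B (x ⊗ₜ b)) =
      lTensor A (mulRight 𝕜 b) x := by
  induction x with
  | zero => simp
  | tmul => simp
  | add x y hx hy => simp only [TensorProduct.add_tmul, map_add, hx, hy]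

theorem rightTwist_tmul (a a₁ : A) (b₁ : B) :
    rightTwist t a (a₁ ⊗ₜ b₁) = rTensor B (mulLeft 𝕜 a₁) (t (b₁ ⊗ₜ a)) := by
  simp [rightTwist, rTensor_mul'_assoc_symm_tmul]

theorem leftTwist_tmul (b b₁ : B) (a₁ : A) :
    leftTwist t b (a₁ ⊗ₜ b₁) = lTensor A (mulRight 𝕜 b₁) (t (b ⊗ₜ a₁)) := by
  simp [leftTwist, lTensor_mul'_assoc_tmul]

theorem rightTwist_apply_eq (a : A) (x : A ⊗[𝕜] B) :
    rightTwist t a x = (rTensor B (mul' 𝕜 A) ∘ₗ (TensorProduct.assoc 𝕜 A A B).symm.toLinearMap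
      ∘ₗ lTensor A t ∘ₗ (TensorProduct.assoc 𝕜 A B A).toLinearMap) (x ⊗ₜ a) := by
  induction x with
  | zero => simp
  | tmul => simp [rightTwist]
  | add x y hx hy => rw [TensorProduct.add_tmul, map_add, map_add, hx, hy]

theorem leftTwist_apply_eq (b : B) (x : A ⊗[𝕜] B) :
    leftTwist t b x = (lTensor A (mul' 𝕜 B) ∘ₗ (TensorProduct.assoc 𝕜 A B B).toLinearMap
      ∘ₗ rTensor B t ∘ₗ (TensorProduct.assoc 𝕜 B A B).symm.toLinearMap) (b ⊗ₜ x) := by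
  induction x with
  | zero => simp
  | tmul => simp [leftTwist]
  | add x y hx hy => rw [TensorProduct.tmul_add, map_add, map_add, hx, hy]

theorem rightTwist_add (a a' : A) : rightTwist t (a + a') = rightTwist t a + rightTwist t a' := by
  ext; simp [rightTwist_tmul, TensorProduct.tmul_add]

theorem leftTwist_add (b b' : B) : leftTwist t (b + b') = leftTwist t b + leftTwist t b' := by
  ext; simp [leftTwist_tmul, TensorProduct.add_tmul]

theorem rightTwist_smul (c : 𝕜) (a : A) : rightTwist t (c • a) = c • rightTwist t a := by
  ext; simp [rightTwist_tmul]

theorem leftTwist_smul (c : 𝕜) (b : B) : leftTwist t (c • b) = c • leftTwist t b := by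
  ext; simp [leftTwist_tmul, ← TensorProduct.smul_tmul']

theorem rightTwist_rTensor_mulLeft (a a₁ : A) (x : A ⊗[𝕜] B) :
    rightTwist t a (rTensor B (mulLeft 𝕜 a₁) x) =
      rTensor B (mulLeft 𝕜 a₁) (rightTwist t a x) := by
  induction x with
  | zero => simp
  | tmul a₂ b₂ => simp [rightTwist_tmul, mulLeft_mul, rTensor_comp]
  | add x y hx hy => simp only [map_add, hx, hy]

theorem leftTwist_lTensor_mulRight (b b₁ : B) (x : A ⊗[𝕜] B) :
    leftTwist t b (lTensor A (mulRight 𝕜 b₁) x) =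
      lTensor A (mulRight 𝕜 b₁) (leftTwist t b x) := by
  induction x with
  | zero => simp
  | tmul a₂ b₂ => simp [leftTwist_tmul, mulRight_mul, lTensor_comp]
  | add x y hx hy => simp only [map_add, hx, hy]

theorem mulTau_tmul_left (a : A) (b : B) (y : A ⊗[𝕜] B) :
    mulTau 𝕜 A B t ((a ⊗ₜ b) ⊗ₜ y) = rTensor B (mulLeft 𝕜 a) (leftTwist t b y) := by
  induction y with
  | zero => simp
  | add x y hx hy => simp only [TensorProduct.tmul_add, map_add, hx, hy]
  | tmul a₁ b₁ =>
    simp only [mulTau, leftTwist_tmul, coe_comp, Function.comp_apply, LinearEquiv.coe_coe,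
      TensorProduct.assoc_tmul, lTensor_tmul, TensorProduct.assoc_symm_tmul, rTensor_tmul]
    induction t (b ⊗ₜ[𝕜] a₁) with
    | zero => simp
    | tmul => simp
    | add x y hx hy => simp only [TensorProduct.add_tmul, TensorProduct.tmul_add, map_add, hx, hy]

theorem mulTau_tmul_right (x : A ⊗[𝕜] B) (a : A) (b : B) :
    mulTau 𝕜 A B t (x ⊗ₜ (a ⊗ₜ b)) = lTensor A (mulRight 𝕜 b) (rightTwist t a x) := by
  induction x with
  | zero => simp
  | add x y hx hy => simp only [TensorProduct.add_tmul, map_add, hx, hy]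
  | tmul a₁ b₁ =>
    rw [mulTau_tmul_left, leftTwist_tmul, rightTwist_tmul,
      ← comp_apply (rTensor B _) (lTensor A _), ← comp_apply (lTensor A _) (rTensor B _),
      rTensor_comp_lTensor, lTensor_comp_rTensor]

/-- The map `a₁ ⊗ b₁ ↦ t(b ⊗ a₁) · t(b₁ ⊗ a)`, where `·` is the multiplication `μ_t`. -/
def sandwichTwist (b : B) (a : A) : A ⊗[𝕜] B →ₗ[𝕜] A ⊗[𝕜] B :=
  mulTau 𝕜 A B t ∘ₗ TensorProduct.map (t ∘ₗ TensorProduct.mk 𝕜 B A b)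
    (t ∘ₗ (TensorProduct.mk 𝕜 B A).flip a)

theorem sandwichTwist_tmul (b b₁ : B) (a a₁ : A) :
    sandwichTwist t b a (a₁ ⊗ₜ b₁) = mulTau 𝕜 A B t (t (b ⊗ₜ a₁) ⊗ₜ t (b₁ ⊗ₜ a)) := by
  simp [sandwichTwist]

theorem twistRHS_tmul (b b' : B) (a a' : A) :
    twistRHS 𝕜 A B t ((b ⊗ₜ b') ⊗ₜ (a ⊗ₜ a')) = sandwichTwist t b a' (t (b' ⊗ₜ a)) := by
  have h : twistRHS 𝕜 A B t = mulTau 𝕜 A B t ∘ₗ TensorProduct.map t t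
      ∘ₗ (TensorProduct.assoc 𝕜 B A (B ⊗[𝕜] A)).symm.toLinearMap
      ∘ₗ LinearMap.lTensor B (TensorProduct.assoc 𝕜 A B A).toLinearMap
      ∘ₗ LinearMap.lTensor B (LinearMap.rTensor A t)
      ∘ₗ LinearMap.lTensor B (TensorProduct.assoc 𝕜 B A A).symm.toLinearMap
      ∘ₗ (TensorProduct.assoc 𝕜 B B (A ⊗[𝕜] A)).toLinearMap := rfl
  simp only [h, coe_comp, Function.comp_apply, LinearEquiv.coe_coe,
    TensorProduct.assoc_tmul, lTensor_tmul, TensorProduct.assoc_symm_tmul, rTensor_tmul]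
  induction t (b' ⊗ₜ[𝕜] a) with
  | zero => simp
  | tmul => simp [sandwichTwist_tmul]
  | add x y hx hy => simp only [TensorProduct.add_tmul, TensorProduct.tmul_add, map_add, hx, hy]

end Actions

section Multiplicativity

variable {𝕜 : Type} [Field 𝕜] {A B : Type} [Ring A] [Algebra 𝕜 A] [Ring B] [Algebra 𝕜 B]
  {𝒜 : ℕ → Submodule 𝕜 A} {ℬ : ℕ → Submodule 𝕜 B} {t : B ⊗[𝕜] A →ₗ[𝕜] A ⊗[𝕜] B}

/-- The identity `t(1 ⊗ μ_A) = (μ_A ⊗ 1)(1 ⊗ t)(t ⊗ 1)` on `B_k ⊗ A_i ⊗ A_j`. -/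
def RightMul (𝒜 : ℕ → Submodule 𝕜 A) (ℬ : ℕ → Submodule 𝕜 B) (t : B ⊗[𝕜] A →ₗ[𝕜] A ⊗[𝕜] B)
    (k i j : ℕ) : Prop :=
  ∀ b ∈ ℬ k, ∀ a ∈ 𝒜 i, ∀ a' ∈ 𝒜 j, t (b ⊗ₜ (a * a')) = rightTwist t a' (t (b ⊗ₜ a))

/-- The identity `t(μ_B ⊗ 1) = (1 ⊗ μ_B)(t ⊗ 1)(1 ⊗ t)` on `B_k ⊗ B_l ⊗ A_i`. -/
def LeftMul (𝒜 : ℕ → Submodule 𝕜 A) (ℬ : ℕ → Submodule 𝕜 B) (t : B ⊗[𝕜] A →ₗ[𝕜] A ⊗[𝕜] B)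
    (k l i : ℕ) : Prop :=
  ∀ b ∈ ℬ k, ∀ b' ∈ ℬ l, ∀ a ∈ 𝒜 i, t ((b * b') ⊗ₜ a) = leftTwist t b (t (b' ⊗ₜ a))

theorem IsGradedMapBA.map_tmul_mem (hgr : IsGradedMapBA 𝕜 A B 𝒜 ℬ t) {k i m : ℕ} (h : k + i = m)
    {b : B} (hb : b ∈ ℬ k) {a : A} (ha : a ∈ 𝒜 i) : t (b ⊗ₜ a) ∈ kunneth 𝕜 𝒜 ℬ m :=
  hgr m ⟨_, tmul_mem_kunneth h hb ha, rfl⟩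

theorem TwistingToDeg.rightMul [GradedAlgebra ℬ] {n : ℕ} (h : TwistingToDeg 𝕜 A B 𝒜 ℬ t n)
    {k i j : ℕ} (hn : k + i + j ≤ n) : RightMul 𝒜 ℬ t k i j := by
  intro b hb a ha a' ha'
  have := h.2.2.2 (k + i + j) hn ((b ⊗ₜ 1) ⊗ₜ (a ⊗ₜ a'))
    (tmul_mem_kunneth (i := k) (j := i + j) (by omega)
      (tmul_mem_kunneth (add_zero k) hb SetLike.GradedOne.one_mem) (tmul_mem_kunneth rfl ha ha'))
  rw [twistRHS_tmul, h.2.1 i (by omega) a ha, sandwichTwist_tmul, h.2.1 j (by omega) a' ha',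
    mulTau_tmul_right] at this
  simpa [twistLHS] using this

theorem TwistingToDeg.leftMul [GradedAlgebra 𝒜] {n : ℕ} (h : TwistingToDeg 𝕜 A B 𝒜 ℬ t n)
    {k l i : ℕ} (hn : k + l + i ≤ n) : LeftMul 𝒜 ℬ t k l i := by
  intro b hb b' hb' a ha
  have := h.2.2.2 (k + l + i) hn ((b ⊗ₜ b') ⊗ₜ (1 ⊗ₜ a))
    (tmul_mem_kunneth (i := k + l) (j := i) rfl
      (tmul_mem_kunneth rfl hb hb')
      (tmul_mem_kunneth (zero_add i) SetLike.GradedOne.one_mem ha))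
  rw [twistRHS_tmul, h.2.2.1 l (by omega) b' hb', sandwichTwist_tmul,
    h.2.2.1 k (by omega) b hb, mulTau_tmul_left] at this
  simpa [twistLHS] using this

theorem RightMul.zero (h0 : 𝒜 0 = 1) (hgr : IsGradedMapBA 𝕜 A B 𝒜 ℬ t) {k i : ℕ}
    (hu : ∀ j ≤ k + i, ∀ b ∈ ℬ j, t (b ⊗ₜ[𝕜] (1 : A)) = (1 : A) ⊗ₜ[𝕜] b) :
    RightMul 𝒜 ℬ t k i 0 := by
  intro b hb a ha a' ha'
  rw [h0, Submodule.mem_one] at ha'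
  obtain ⟨c, rfl⟩ := ha'
  have h : rightTwist t 1 (t (b ⊗ₜ a)) = LinearMap.id (R := 𝕜) (t (b ⊗ₜ a)) :=
    kunneth_eqOn (fun p q hpq a₁ _ b₁ hb₁ => by
      rw [rightTwist_tmul, hu q (by omega) b₁ hb₁]; simp) (hgr.map_tmul_mem rfl hb ha)
  rw [Algebra.algebraMap_eq_smul_one, rightTwist_smul, LinearMap.smul_apply, h]
  simp

theorem LeftMul.zero (h0 : ℬ 0 = 1) (hgr : IsGradedMapBA 𝕜 A B 𝒜 ℬ t) {l i : ℕ}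
    (hu : ∀ j ≤ l + i, ∀ a ∈ 𝒜 j, t ((1 : B) ⊗ₜ[𝕜] a) = a ⊗ₜ[𝕜] (1 : B)) :
    LeftMul 𝒜 ℬ t 0 l i := by
  intro b hb b' hb' a ha
  rw [h0, Submodule.mem_one] at hb
  obtain ⟨c, rfl⟩ := hb
  have h : leftTwist t 1 (t (b' ⊗ₜ a)) = LinearMap.id (R := 𝕜) (t (b' ⊗ₜ a)) :=
    kunneth_eqOn (fun p q hpq a₁ ha₁ b₁ _ => by
      rw [leftTwist_tmul, hu p (by omega) a₁ ha₁]; simp) (hgr.map_tmul_mem rfl hb' ha)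
  rw [Algebra.algebraMap_eq_smul_one, leftTwist_smul, LinearMap.smul_apply, h]
  simp [← TensorProduct.smul_tmul']

theorem RightMul.succ [GradedAlgebra 𝒜] (hgr : IsGradedMapBA 𝕜 A B 𝒜 ℬ t) {k i j : ℕ}
    (hmul : 𝒜 (j + 1) = 𝒜 j * 𝒜 1) (h : RightMul 𝒜 ℬ t k i j)
    (h1 : ∀ k' i', k' + i' ≤ k + i + j → RightMul 𝒜 ℬ t k' i' 1) :
    RightMul 𝒜 ℬ t k i (j + 1) := by
  intro b hb a ha a' ha'
  rw [hmul] at ha'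
  refine Submodule.mul_induction_on ha' (fun a' ha' v hv => ?_) fun x y hx hy => ?_
  · rw [← mul_assoc, h1 k (i + j) (by omega) b hb _ (SetLike.mul_mem_graded ha ha') v hv,
      h b hb a ha a' ha', ← comp_apply]
    refine kunneth_eqOn (fun p q hpq a₁ _ b₁ hb₁ => ?_) (hgr.map_tmul_mem rfl hb ha)
    rw [comp_apply, rightTwist_tmul, rightTwist_tmul, rightTwist_rTensor_mulLeft,
      h1 q j (by omega) b₁ hb₁ a' ha' v hv]
  · rw [mul_add, TensorProduct.tmul_add, map_add, hx, hy, rightTwist_add, LinearMap.add_apply]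

theorem LeftMul.succ [GradedAlgebra ℬ] (hgr : IsGradedMapBA 𝕜 A B 𝒜 ℬ t) {k l i : ℕ}
    (hmul : ℬ (k + 1) = ℬ 1 * ℬ k) (h : LeftMul 𝒜 ℬ t k l i)
    (h1 : ∀ l' i', l' + i' ≤ k + l + i → LeftMul 𝒜 ℬ t 1 l' i') :
    LeftMul 𝒜 ℬ t (k + 1) l i := by
  intro b hb b' hb' a ha
  rw [hmul] at hb
  refine Submodule.mul_induction_on hb (fun v hv b hb => ?_) fun x y hx hy => ?_
  · rw [mul_assoc, h1 (k + l) i le_rfl v hv _ (SetLike.mul_mem_graded hb hb') a ha,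
      h b hb b' hb' a ha, ← comp_apply]
    refine kunneth_eqOn (fun p q hpq a₁ ha₁ b₁ _ => ?_) (hgr.map_tmul_mem rfl hb' ha)
    rw [comp_apply, leftTwist_tmul, leftTwist_tmul, leftTwist_lTensor_mulRight,
      h1 k p (by omega) v hv b hb a₁ ha₁]
  · rw [add_mul, TensorProduct.add_tmul, map_add, hx, hy, leftTwist_add, LinearMap.add_apply]

/-- The one-sided multiplicativity identities up to degree `n` imply the two-sided one. -/
theorem twistLHS_eq_twistRHS [GradedAlgebra ℬ] (hgr : IsGradedMapBA 𝕜 A B 𝒜 ℬ t) {n : ℕ}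
    (hR : ∀ k i j, k + i + j ≤ n → RightMul 𝒜 ℬ t k i j)
    (hL : ∀ k l i, k + l + i ≤ n → LeftMul 𝒜 ℬ t k l i) {m : ℕ} (hm : m ≤ n)
    {x : (B ⊗[𝕜] B) ⊗[𝕜] (A ⊗[𝕜] A)}
    (hx : x ∈ kunneth 𝕜 (kunneth 𝕜 ℬ ℬ) (kunneth 𝕜 𝒜 𝒜) m) :
    twistLHS 𝕜 A B t x = twistRHS 𝕜 A B t x := by
  refine kunneth_eqOn (fun r s hrs y hy z hz => ?_) hx
  suffices H : (twistLHS 𝕜 A B t ∘ₗ (TensorProduct.mk 𝕜 _ _).flip z) y =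
      (twistRHS 𝕜 A B t ∘ₗ (TensorProduct.mk 𝕜 _ _).flip z) y from H
  refine kunneth_eqOn (fun k l hkl b hb b' hb' => ?_) hy
  suffices H : (twistLHS 𝕜 A B t ∘ₗ TensorProduct.mk 𝕜 _ _ (b ⊗ₜ b')) z =
      (twistRHS 𝕜 A B t ∘ₗ TensorProduct.mk 𝕜 _ _ (b ⊗ₜ b')) z from H
  refine kunneth_eqOn (fun i j hij a ha a' ha' => ?_) hz
  rw [comp_apply, comp_apply, TensorProduct.mk_apply, twistRHS_tmul]
  have hlhs : twistLHS 𝕜 A B t ((b ⊗ₜ b') ⊗ₜ (a ⊗ₜ a')) = t ((b * b') ⊗ₜ (a * a')) := by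
    simp [twistLHS]
  rw [hlhs, hR (k + l) i j (by omega) _ (SetLike.mul_mem_graded hb hb') a ha a' ha',
    hL k l i (by omega) b hb b' hb' a ha, ← comp_apply]
  refine kunneth_eqOn (fun p q hpq a₁ ha₁ b₁ hb₁ => ?_) (hgr.map_tmul_mem rfl hb' ha)
  rw [comp_apply, leftTwist_tmul, sandwichTwist_tmul]
  suffices H : (rightTwist t a' ∘ₗ lTensor A (mulRight 𝕜 b₁)) (t (b ⊗ₜ a₁)) =
      (mulTau 𝕜 A B t ∘ₗ (TensorProduct.mk 𝕜 _ _).flip (t (b₁ ⊗ₜ a'))) (t (b ⊗ₜ a₁)) from H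
  refine kunneth_eqOn (fun u v huv a₂ _ b₂ hb₂ => ?_) (hgr.map_tmul_mem rfl hb ha₁)
  rw [comp_apply, comp_apply, flip_apply, TensorProduct.mk_apply, mulTau_tmul_left,
    lTensor_tmul, mulRight_apply, rightTwist_tmul,
    hL v q j (by omega) b₂ hb₂ b₁ hb₁ a' ha']

end Multiplicativity

/-- Theorem 3.2 ("simpler extension condition").  Let `A` and `B` be one-generated
connected graded algebras and let `t : B ⊗ A → A ⊗ B` be a graded linear map satisfying
the unital conditions (in degrees `≤ n+1`) such that (1) `t` is graded twisting to degree
`n`, (2) `t(1_B ⊗ μ_A) = (μ_A ⊗ 1_B)(1_A ⊗ t)(t ⊗ 1_A)` on `(B ⊗ A ⊗ A₁)_{n+1}` and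
(3) `t(μ_B ⊗ 1_A) = (1_A ⊗ μ_B)(t ⊗ 1_B)(1_B ⊗ t)` on `(B₁ ⊗ B ⊗ A)_{n+1}`.
Then `t` is graded twisting to degree `n + 1`. -/
theorem stmt3 (𝕜 : Type) [Field 𝕜] (A B : Type) [Ring A] [Algebra 𝕜 A] [Ring B] [Algebra 𝕜 B]
    (𝒜 : ℕ → Submodule 𝕜 A) (ℬ : ℕ → Submodule 𝕜 B)
    [GradedAlgebra 𝒜] [GradedAlgebra ℬ]
    (hconnA : 𝒜 0 = (1 : Submodule 𝕜 A)) (hconnB : ℬ 0 = (1 : Submodule 𝕜 B))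
    (honegenA : ∀ m : ℕ, 1 ≤ m → 𝒜 m = 𝒜 1 ^ m)
    (honegenB : ∀ m : ℕ, 1 ≤ m → ℬ m = ℬ 1 ^ m)
    (n : ℕ) (hn : 0 < n)
    (t : B ⊗[𝕜] A →ₗ[𝕜] A ⊗[𝕜] B)
    (hgr : IsGradedMapBA 𝕜 A B 𝒜 ℬ t)
    (hu1 : ∀ j ≤ n + 1, ∀ a ∈ 𝒜 j, t ((1 : B) ⊗ₜ[𝕜] a) = a ⊗ₜ[𝕜] (1 : B))
    (hu2 : ∀ j ≤ n + 1, ∀ b ∈ ℬ j, t (b ⊗ₜ[𝕜] (1 : A)) = (1 : A) ⊗ₜ[𝕜] b)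
    (h1 : TwistingToDeg 𝕜 A B 𝒜 ℬ t n)
    (h2 : ∀ x ∈ kunneth 𝕜 (kunneth 𝕜 ℬ 𝒜) (degOne 𝕜 𝒜) (n + 1),
      (t ∘ₗ lTensor B (mul' 𝕜 A) ∘ₗ (TensorProduct.assoc 𝕜 B A A).toLinearMap) x =
      (rTensor B (mul' 𝕜 A) ∘ₗ (TensorProduct.assoc 𝕜 A A B).symm.toLinearMap
        ∘ₗ lTensor A t ∘ₗ (TensorProduct.assoc 𝕜 A B A).toLinearMap ∘ₗ rTensor A t) x)
    (h3 : ∀ x ∈ kunneth 𝕜 (degOne 𝕜 ℬ) (kunneth 𝕜 ℬ 𝒜) (n + 1),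
      (t ∘ₗ rTensor A (mul' 𝕜 B) ∘ₗ (TensorProduct.assoc 𝕜 B B A).symm.toLinearMap) x =
      (lTensor A (mul' 𝕜 B) ∘ₗ (TensorProduct.assoc 𝕜 A B B).toLinearMap
        ∘ₗ rTensor B t ∘ₗ (TensorProduct.assoc 𝕜 B A B).symm.toLinearMap ∘ₗ lTensor B t) x) :
    TwistingToDeg 𝕜 A B 𝒜 ℬ t (n + 1) := by
  have hR1 : ∀ k i, k + i ≤ n → RightMul 𝒜 ℬ t k i 1 := by
    intro k i hki
    rcases hki.lt_or_eq with hlt | heq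
    · exact h1.rightMul (by omega)
    · intro b hb a ha v hv
      have := h2 ((b ⊗ₜ a) ⊗ₜ v)
        (kunneth_degOne_right_mem (i := n) rfl (tmul_mem_kunneth heq hb ha) hv)
      simpa [rightTwist_apply_eq] using this
  have hL1 : ∀ l i, l + i ≤ n → LeftMul 𝒜 ℬ t 1 l i := by
    intro l i hli
    rcases hli.lt_or_eq with hlt | heq
    · exact h1.leftMul (by omega)
    · intro v hv b hb a ha
      have := h3 (v ⊗ₜ (b ⊗ₜ a))
        (kunneth_degOne_left_mem (j := n) (add_comm 1 n) hv (tmul_mem_kunneth heq hb ha))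
      simpa [leftTwist_apply_eq] using this
  refine ⟨hgr, hu1, hu2, fun m hm x hx => twistLHS_eq_twistRHS hgr (n := n + 1) ?_ ?_ hm hx⟩
  · rintro k i (_ | j) hkij
    · exact .zero hconnA hgr fun q hq => hu2 q (by omega)
    · exact .succ hgr (grade_succ_eq_mul_grade_one hconnA honegenA j) (h1.rightMul (by omega))
        fun k' i' h => hR1 k' i' (by omega)
  · rintro (_ | k) l i hkli
    · exact .zero hconnB hgr fun p hp => hu1 p (by omega)
    · exact .succ hgr (grade_succ_eq_grade_one_mul hconnB honegenB k) (h1.leftMul (by omega))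
        fun l' i' h => hL1 l' i' (by omega)

end TTP
end
end

section
/- Let A₁ and B₁ be finite-dimensional 𝕜-vector spaces, A = T(A₁) and B = T(B₁) the tensor algebras with weight grading, and let B₁ = B₁' ⊕ B₁'' be a direct-sum decomposition. Suppose t: B₁⊗A₁ → A⊗B is a linear map such that t(B₁'⊗A₁) ⊆ A₁⊗B₁' ⊕ A₂⊗B₀ and t(B₁''⊗A₁) ⊆ A₁⊗B₁'' ⊕ A₀⊗μ_B(B₁⊗B₁''). Then there exists a graded twisting map τ: B⊗A → A⊗B whose restriction to B₁⊗A₁ equals t. -/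
open TensorProduct

noncomputable section

namespace TTP

/-- The space `T(V) ⊗ T(W)` underlying the twisted tensor product, a left `T(V)`-module. -/
abbrev TT (𝕜 V W : Type) [Field 𝕜] [AddCommGroup V] [Module 𝕜 V] [AddCommGroup W]
    [Module 𝕜 W] : Type :=
  TensorAlgebra 𝕜 V ⊗[𝕜] TensorAlgebra 𝕜 W

section TensorAlgebras

variable {𝕜 : Type} [Field 𝕜] {V W : Type}
  [AddCommGroup V] [Module 𝕜 V] [AddCommGroup W] [Module 𝕜 W]

open TensorAlgebra Filter

/-- The submodule of sequences that are eventually constant with value in `S`. -/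
def eventuallyConst {M : Type} [AddCommGroup M] [Module 𝕜 M] (S : Submodule 𝕜 M) :
    Submodule 𝕜 (ℕ → M) where
  carrier := {f | ∃ y ∈ S, ∀ᶠ n in atTop, f n = y}
  add_mem' := by
    rintro f g ⟨y, hy, hf⟩ ⟨z, hz, hg⟩
    refine ⟨y + z, S.add_mem hy hz, ?_⟩
    filter_upwards [hf, hg] with n h1 h2
    simp [h1, h2]
  zero_mem' := ⟨0, S.zero_mem, by simp⟩
  smul_mem' := by
    rintro c f ⟨y, hy, hf⟩
    refine ⟨c • y, S.smul_mem c hy, ?_⟩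
    filter_upwards [hf] with n h1
    simp [h1]

lemma eventuallyConst_mono {M : Type} [AddCommGroup M] [Module 𝕜 M] {S T : Submodule 𝕜 M}
    (h : S ≤ T) : eventuallyConst S ≤ eventuallyConst T := by
  rintro f ⟨y, hy, hf⟩
  exact ⟨y, h hy, hf⟩

lemma eventuallyConst_of_succ {M : Type} [AddCommGroup M] [Module 𝕜 M] {S : Submodule 𝕜 M}
    {f : ℕ → M} (h : (fun n => f (n + 1)) ∈ eventuallyConst S) : f ∈ eventuallyConst S := by
  obtain ⟨y, hy, hf⟩ := h
  refine ⟨y, hy, ?_⟩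
  obtain ⟨N, hN⟩ := eventually_atTop.1 hf
  refine eventually_atTop.2 ⟨N + 1, fun n hn => ?_⟩
  obtain ⟨m, rfl⟩ : ∃ m, n = m + 1 := ⟨n - 1, by omega⟩
  exact hN m (by omega)

/-- A pointwise eventually constant sequence of linear maps has a linear pointwise limit. -/
lemma exists_limit_of_eventuallyConst {M N : Type} [AddCommGroup M] [Module 𝕜 M]
    [AddCommGroup N] [Module 𝕜 N] (f : ℕ → M →ₗ[𝕜] N)
    (h : ∀ m, ∃ y, ∀ᶠ n in atTop, f n m = y) :
    ∃ g : M →ₗ[𝕜] N, ∀ m, ∀ᶠ n in atTop, f n m = g m := by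
  choose g hg using h
  refine ⟨{ toFun := g, map_add' := fun x y => ?_, map_smul' := fun c x => ?_ }, hg⟩
  · obtain ⟨n, ⟨h1, h2⟩, h3⟩ := (((hg x).and (hg y)).and (hg (x + y))).exists
    rw [← h1, ← h2, ← h3, map_add]
  · obtain ⟨n, h1, h2⟩ := ((hg x).and (hg (c • x))).exists
    rw [← h1, ← h2, map_smul, RingHom.id_apply]

lemma subTmul_le {M N : Type} [AddCommGroup M] [Module 𝕜 M] [AddCommGroup N] [Module 𝕜 N]
    {p : Submodule 𝕜 M} {q : Submodule 𝕜 N} {S : Submodule 𝕜 (M ⊗[𝕜] N)}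
    (h : ∀ a ∈ p, ∀ b ∈ q, a ⊗ₜ[𝕜] b ∈ S) : subTmul 𝕜 p q ≤ S := by
  rintro _ ⟨x, rfl⟩
  induction x using TensorProduct.induction_on with
  | zero => simp
  | tmul a b => exact h a a.2 b b.2
  | add x y hx hy => rw [map_add]; exact S.add_mem hx hy

lemma tmul_mem_subTmul {M N : Type} [AddCommGroup M] [Module 𝕜 M] [AddCommGroup N]
    [Module 𝕜 N] {p : Submodule 𝕜 M} {q : Submodule 𝕜 N} {a : M} {b : N} (ha : a ∈ p)
    (hb : b ∈ q) : a ⊗ₜ[𝕜] b ∈ subTmul 𝕜 p q :=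
  ⟨⟨a, ha⟩ ⊗ₜ ⟨b, hb⟩, rfl⟩

lemma kunneth_le {M N : Type} [AddCommGroup M] [Module 𝕜 M] [AddCommGroup N] [Module 𝕜 N]
    {𝒜 : ℕ → Submodule 𝕜 M} {ℬ : ℕ → Submodule 𝕜 N} {n : ℕ} {S : Submodule 𝕜 (M ⊗[𝕜] N)}
    (h : ∀ p q, p + q = n → ∀ a ∈ 𝒜 p, ∀ b ∈ ℬ q, a ⊗ₜ[𝕜] b ∈ S) : kunneth 𝕜 𝒜 ℬ n ≤ S :=
  iSup₂_le fun pq hpq => subTmul_le (h pq.1 pq.2 hpq)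

lemma tmul_mem_kunneth_s4 {M N : Type} [AddCommGroup M] [Module 𝕜 M] [AddCommGroup N]
    [Module 𝕜 N] {𝒜 : ℕ → Submodule 𝕜 M} {ℬ : ℕ → Submodule 𝕜 N} {p q n : ℕ}
    (hpq : p + q = n) {a : M} {b : N} (ha : a ∈ 𝒜 p) (hb : b ∈ ℬ q) :
    a ⊗ₜ[𝕜] b ∈ kunneth 𝕜 𝒜 ℬ n :=
  le_iSup₂_of_le (f := fun (pq : ℕ × ℕ) (_ : pq.1 + pq.2 = n) => subTmul 𝕜 (𝒜 pq.1) (ℬ pq.2))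
    (p, q) hpq le_rfl (tmul_mem_subTmul ha hb)

lemma tensorWeight_zero : tensorWeight 𝕜 V 0 = 1 := pow_zero _

lemma tensorWeight_one : tensorWeight 𝕜 V 1 = LinearMap.range (ι 𝕜 (M := V)) := pow_one _

lemma ι_mem_tensorWeight_one (v : V) : ι 𝕜 v ∈ tensorWeight 𝕜 V 1 := by
  rw [tensorWeight_one]; exact ⟨v, rfl⟩

lemma mul_mem_tensorWeight {p q : ℕ} {a b : TensorAlgebra 𝕜 V} (ha : a ∈ tensorWeight 𝕜 V p)
    (hb : b ∈ tensorWeight 𝕜 V q) : a * b ∈ tensorWeight 𝕜 V (p + q) := by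
  unfold tensorWeight; rw [pow_add]; exact Submodule.mul_mem_mul ha hb

lemma tensorWeight_succ_le {p : ℕ} {S : Submodule 𝕜 (TensorAlgebra 𝕜 V)}
    (h : ∀ v : V, ∀ a ∈ tensorWeight 𝕜 V p, ι 𝕜 v * a ∈ S) : tensorWeight 𝕜 V (p + 1) ≤ S := by
  unfold tensorWeight
  rw [pow_succ', Submodule.mul_le]
  rintro _ ⟨v, rfl⟩ a ha
  exact h v a ha

/-- `T(V)` is generated from scalars by left multiplication with elements of `V`. -/
lemma left_induction {S : Submodule 𝕜 (TensorAlgebra 𝕜 V)} (h1 : 1 ∈ S)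
    (hι : ∀ v : V, ∀ a ∈ S, ι 𝕜 v * a ∈ S) (a : TensorAlgebra 𝕜 V) : a ∈ S := by
  suffices ∀ x ∈ S, a * x ∈ S by simpa using this 1 h1
  induction a using TensorAlgebra.induction with
  | algebraMap r => intro x hx; rw [← Algebra.smul_def]; exact S.smul_mem r hx
  | ι v => exact hι v
  | mul a b ha hb => intro x hx; rw [mul_assoc]; exact ha _ (hb x hx)
  | add a b ha hb => intro x hx; rw [add_mul]; exact S.add_mem (ha x hx) (hb x hx)

/-- `T(V) ⊗ T(W)` is generated from `1 ⊗ T(W)` by left multiplication with elements of `V`. -/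
lemma TT.mem_of_left {S : Submodule 𝕜 (TT 𝕜 V W)} (h1 : ∀ b, (1 : TensorAlgebra 𝕜 V) ⊗ₜ b ∈ S)
    (hι : ∀ v : V, ∀ m ∈ S, ι 𝕜 v • m ∈ S) (m : TT 𝕜 V W) : m ∈ S := by
  induction m using TensorProduct.induction_on with
  | zero => exact S.zero_mem
  | add x y hx hy => exact S.add_mem hx hy
  | tmul a b =>
    refine left_induction (S := S.comap ((TensorProduct.mk 𝕜 _ _).flip b)) ?_ ?_ a
    · exact h1 b
    · intro v a ha
      have := hι v _ ha
      simpa [TensorProduct.smul_tmul'] using this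

/-- Left multiplication by `T(V)` on `T(V) ⊗ T(W)`. -/
def leftMul : TensorAlgebra 𝕜 V →ₐ[𝕜] Module.End 𝕜 (TT 𝕜 V W) :=
  Algebra.lsmul 𝕜 𝕜 (TT 𝕜 V W)

@[simp] lemma leftMul_apply (a : TensorAlgebra 𝕜 V) (m : TT 𝕜 V W) : leftMul a m = a • m := rfl

/-- Right multiplication by `T(W)` on `T(V) ⊗ T(W)`. -/
def rightMul (b : TensorAlgebra 𝕜 W) : TT 𝕜 V W →ₗ[𝕜] TT 𝕜 V W :=
  LinearMap.lTensor _ (LinearMap.mulRight 𝕜 b)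

@[simp] lemma rightMul_tmul (b b' : TensorAlgebra 𝕜 W) (a : TensorAlgebra 𝕜 V) :
    rightMul b (a ⊗ₜ[𝕜] b') = a ⊗ₜ (b' * b) := rfl

lemma rightMul_smul (b : TensorAlgebra 𝕜 W) (a : TensorAlgebra 𝕜 V) (m : TT 𝕜 V W) :
    rightMul b (a • m) = a • rightMul b m := by
  induction m using TensorProduct.induction_on with
  | zero => simp
  | add x y hx hy => simp only [smul_add, map_add, hx, hy]
  | tmul a' b' => simp [TensorProduct.smul_tmul']

/-- The recursor of `T(V) ⊗ T(W)` along left multiplication by `V`. -/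
lemma TT.exists_rec {N : Type} [AddCommMonoid N] [Module 𝕜 N] (f : TensorAlgebra 𝕜 W →ₗ[𝕜] N)
    (g : V →ₗ[𝕜] TT 𝕜 V W →ₗ[𝕜] N) :
    ∃ h : TT 𝕜 V W →ₗ[𝕜] N, (∀ b, h (1 ⊗ₜ b) = f b) ∧ ∀ v m, h (ι 𝕜 v • m) = g v m := by
  let step : V →ₗ[𝕜] Module.End 𝕜 (TT 𝕜 V W × N) :=
    { toFun := fun v => ((leftMul (ι 𝕜 v)).prod (g v)) ∘ₗ LinearMap.fst 𝕜 _ _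
      map_add' := fun v w => by ext <;> simp
      map_smul' := fun c v => by ext <;> simp }
  let φ := TensorAlgebra.lift 𝕜 step
  have hφι : ∀ v x, φ (ι 𝕜 v) x = (ι 𝕜 v • x.1, g v x.1) := fun v x => by
    simp [φ, step]
  have hφ : ∀ a x, (φ a x).1 = a • x.1 := by
    intro a
    induction a using TensorAlgebra.induction with
    | algebraMap r => intro x; simp [φ]
    | ι v => intro x; rw [hφι]
    | mul a b ha hb => intro x; simp [ha, hb, mul_smul]
    | add a b ha hb => intro x; simp [ha, hb, add_smul]
  let base : TensorAlgebra 𝕜 W →ₗ[𝕜] TT 𝕜 V W × N :=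
    (TensorProduct.mk 𝕜 (TensorAlgebra 𝕜 V) (TensorAlgebra 𝕜 W) 1).prod f
  let H : TT 𝕜 V W →ₗ[𝕜] TT 𝕜 V W × N :=
    TensorProduct.lift ((LinearMap.lcomp 𝕜 _ base) ∘ₗ φ.toLinearMap)
  have hH : ∀ a b, H (a ⊗ₜ b) = φ a (1 ⊗ₜ b, f b) := fun a b => by simp [H, base]
  have hH1 : ∀ m, (H m).1 = m := by
    intro m
    induction m using TensorProduct.induction_on with
    | zero => simp
    | add x y hx hy => simp [hx, hy]
    | tmul a b => simp [hH, hφ, TensorProduct.smul_tmul']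
  have hHι : ∀ v m, H (ι 𝕜 v • m) = φ (ι 𝕜 v) (H m) := by
    intro v m
    induction m using TensorProduct.induction_on with
    | zero => simp
    | add x y hx hy => simp only [smul_add, map_add, hx, hy]
    | tmul a b => simp [hH, TensorProduct.smul_tmul']
  refine ⟨LinearMap.snd 𝕜 _ _ ∘ₗ H, fun b => by simp [hH], fun v m => ?_⟩
  simp [hHι, hφι, hH1]

/-- The map `a ⊗ b ↦ L_a ∘ ρ(b)` from `T(V) ⊗ T(W)` to its endomorphisms, where `ρ` is the
action of `T(W)` extending `P`. -/
def theta (P : W →ₗ[𝕜] Module.End 𝕜 (TT 𝕜 V W)) : TT 𝕜 V W →ₗ[𝕜] Module.End 𝕜 (TT 𝕜 V W) :=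
  TensorProduct.lift ((LinearMap.mul 𝕜 (Module.End 𝕜 (TT 𝕜 V W))).compl₁₂
    leftMul.toLinearMap (TensorAlgebra.lift 𝕜 P).toLinearMap)

@[simp] lemma theta_tmul (P : W →ₗ[𝕜] Module.End 𝕜 (TT 𝕜 V W)) (a : TensorAlgebra 𝕜 V)
    (b : TensorAlgebra 𝕜 W) (m : TT 𝕜 V W) :
    theta P (a ⊗ₜ b) m = a • TensorAlgebra.lift 𝕜 P b m := rfl

lemma theta_smul (P : W →ₗ[𝕜] Module.End 𝕜 (TT 𝕜 V W)) (a : TensorAlgebra 𝕜 V)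
    (x m : TT 𝕜 V W) : theta P (a • x) m = a • theta P x m := by
  induction x using TensorProduct.induction_on with
  | zero => simp
  | add x y hx hy => simp only [smul_add, map_add, LinearMap.add_apply, hx, hy]
  | tmul a' b' => simp [TensorProduct.smul_tmul', mul_smul]

lemma exists_rewriteStep (t : W ⊗[𝕜] V →ₗ[𝕜] TT 𝕜 V W)
    (P : W →ₗ[𝕜] Module.End 𝕜 (TT 𝕜 V W)) :
    ∃ Q : W →ₗ[𝕜] Module.End 𝕜 (TT 𝕜 V W), (∀ w b, Q w (1 ⊗ₜ b) = 1 ⊗ₜ (ι 𝕜 w * b)) ∧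
      ∀ w v m, Q w (ι 𝕜 v • m) = theta P (t (w ⊗ₜ v)) m := by
  let f : TensorAlgebra 𝕜 W →ₗ[𝕜] W →ₗ[𝕜] TT 𝕜 V W :=
    LinearMap.mk₂ 𝕜 (fun b w => 1 ⊗ₜ (ι 𝕜 w * b))
      (by intros; simp [mul_add, TensorProduct.tmul_add]) (by intros; simp)
      (by intros; simp [add_mul, TensorProduct.tmul_add]) (by intros; simp)
  let X : W →ₗ[𝕜] V →ₗ[𝕜] TT 𝕜 V W →ₗ[𝕜] TT 𝕜 V W :=
    (TensorProduct.mk 𝕜 W V).compr₂ (theta P ∘ₗ t)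
  let g : V →ₗ[𝕜] TT 𝕜 V W →ₗ[𝕜] W →ₗ[𝕜] TT 𝕜 V W :=
    { toFun := fun v => (X.flip v).flip
      map_add' := fun v w => by ext; simp
      map_smul' := fun c v => by ext; simp }
  obtain ⟨h, hb, hs⟩ := TT.exists_rec f g
  exact ⟨h.flip, fun w b => by simp [hb, f], fun w v m => by simp [hs, g, X]⟩

/-- One rewriting step: `Q(w)(v • m) = Θ_P(t(w ⊗ v))(m)` and `Q(w)(1 ⊗ b) = 1 ⊗ wb`. -/
def rewriteStep (t : W ⊗[𝕜] V →ₗ[𝕜] TT 𝕜 V W) (P : W →ₗ[𝕜] Module.End 𝕜 (TT 𝕜 V W)) :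
    W →ₗ[𝕜] Module.End 𝕜 (TT 𝕜 V W) :=
  (exists_rewriteStep t P).choose

@[simp] lemma rewriteStep_one_tmul (t : W ⊗[𝕜] V →ₗ[𝕜] TT 𝕜 V W)
    (P : W →ₗ[𝕜] Module.End 𝕜 (TT 𝕜 V W)) (w : W) (b : TensorAlgebra 𝕜 W) :
    rewriteStep t P w (1 ⊗ₜ b) = 1 ⊗ₜ (ι 𝕜 w * b) :=
  (exists_rewriteStep t P).choose_spec.1 w b

@[simp] lemma rewriteStep_smul (t : W ⊗[𝕜] V →ₗ[𝕜] TT 𝕜 V W)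
    (P : W →ₗ[𝕜] Module.End 𝕜 (TT 𝕜 V W)) (w : W) (v : V) (m : TT 𝕜 V W) :
    rewriteStep t P w (ι 𝕜 v • m) = theta P (t (w ⊗ₜ v)) m :=
  (exists_rewriteStep t P).choose_spec.2 w v m

/-- Iterated rewriting, starting from zero. -/
def rewriteIter (t : W ⊗[𝕜] V →ₗ[𝕜] TT 𝕜 V W) : ℕ → W →ₗ[𝕜] Module.End 𝕜 (TT 𝕜 V W)
  | 0 => 0
  | n + 1 => rewriteStep t (rewriteIter t n)

lemma lift_commute {P : W →ₗ[𝕜] Module.End 𝕜 (TT 𝕜 V W)} {b : TensorAlgebra 𝕜 W}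
    (h : ∀ w m, P w (rightMul b m) = rightMul b (P w m)) (b' : TensorAlgebra 𝕜 W) :
    ∀ m, TensorAlgebra.lift 𝕜 P b' (rightMul b m) =
      rightMul b (TensorAlgebra.lift 𝕜 P b' m) := by
  induction b' using TensorAlgebra.induction with
  | algebraMap r => intro m; simp
  | ι w => intro m; simp [h]
  | mul a c ha hc => intro m; simp [ha, hc]
  | add a c ha hc => intro m; simp [ha, hc]

lemma rewriteIter_commute (t : W ⊗[𝕜] V →ₗ[𝕜] TT 𝕜 V W) (b : TensorAlgebra 𝕜 W) (n : ℕ) :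
    ∀ w m, rewriteIter t n w (rightMul b m) = rightMul b (rewriteIter t n w m) := by
  induction n with
  | zero => intro w m; simp [rewriteIter]
  | succ n ih =>
    intro w m
    refine TT.mem_of_left (S := LinearMap.eqLocus ((rewriteIter t (n + 1) w) ∘ₗ rightMul b)
      (rightMul b ∘ₗ rewriteIter t (n + 1) w)) ?_ ?_ m
    · intro b'; simp [rewriteIter, mul_assoc]
    · intro v m _
      simp only [rewriteIter, LinearMap.mem_eqLocus, LinearMap.comp_apply, rightMul_smul,
        rewriteStep_smul]
      generalize t (w ⊗ₜ v) = x
      induction x using TensorProduct.induction_on with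
      | zero => simp
      | add x y hx hy => simp only [map_add, LinearMap.add_apply, hx, hy]
      | tmul a c => simp [lift_commute ih, rightMul_smul]

lemma smul_mem_kunneth {p q : ℕ} {a : TensorAlgebra 𝕜 V} {m : TT 𝕜 V W}
    (ha : a ∈ tensorWeight 𝕜 V p) (hm : m ∈ kunneth 𝕜 (tensorWeight 𝕜 V) (tensorWeight 𝕜 W) q) :
    a • m ∈ kunneth 𝕜 (tensorWeight 𝕜 V) (tensorWeight 𝕜 W) (p + q) := by
  refine kunneth_le (S := (kunneth 𝕜 (tensorWeight 𝕜 V) (tensorWeight 𝕜 W) (p + q)).comap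
    (leftMul a)) ?_ hm
  intro i j hij c hc d hd
  simp only [Submodule.mem_comap, leftMul_apply, TensorProduct.smul_tmul', smul_eq_mul]
  exact tmul_mem_kunneth_s4 (by omega) (mul_mem_tensorWeight ha hc) hd

lemma lift_mem_kunneth {P : W →ₗ[𝕜] Module.End 𝕜 (TT 𝕜 V W)}
    (hP : ∀ w j, ∀ m ∈ kunneth 𝕜 (tensorWeight 𝕜 V) (tensorWeight 𝕜 W) j,
      P w m ∈ kunneth 𝕜 (tensorWeight 𝕜 V) (tensorWeight 𝕜 W) (j + 1))
    {j : ℕ} {m : TT 𝕜 V W} (hm : m ∈ kunneth 𝕜 (tensorWeight 𝕜 V) (tensorWeight 𝕜 W) j)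
    {q : ℕ} {b : TensorAlgebra 𝕜 W} (hb : b ∈ tensorWeight 𝕜 W q) :
    TensorAlgebra.lift 𝕜 P b m ∈ kunneth 𝕜 (tensorWeight 𝕜 V) (tensorWeight 𝕜 W) (q + j) := by
  induction q generalizing b with
  | zero =>
    rw [tensorWeight_zero, Submodule.mem_one] at hb
    obtain ⟨r, rfl⟩ := hb
    simpa using Submodule.smul_mem _ r hm
  | succ q ih =>
    refine tensorWeight_succ_le (S := (kunneth 𝕜 (tensorWeight 𝕜 V) (tensorWeight 𝕜 W)
      (q + 1 + j)).comap ((TensorAlgebra.lift 𝕜 P).toLinearMap.flip m)) ?_ hb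
    intro w b hb
    have := hP w _ _ (ih hb)
    rw [show q + 1 + j = q + j + 1 by omega]
    simpa using this

lemma rewriteIter_mem_kunneth {t : W ⊗[𝕜] V →ₗ[𝕜] TT 𝕜 V W}
    (ht : ∀ w v, t (w ⊗ₜ v) ∈ kunneth 𝕜 (tensorWeight 𝕜 V) (tensorWeight 𝕜 W) 2) (n : ℕ) :
    ∀ w j, ∀ m ∈ kunneth 𝕜 (tensorWeight 𝕜 V) (tensorWeight 𝕜 W) j,
      rewriteIter t n w m ∈ kunneth 𝕜 (tensorWeight 𝕜 V) (tensorWeight 𝕜 W) (j + 1) := by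
  induction n with
  | zero => intro w j m _; simp [rewriteIter]
  | succ n ih =>
    intro w j m hm
    refine kunneth_le (S := (kunneth 𝕜 (tensorWeight 𝕜 V) (tensorWeight 𝕜 W) (j + 1)).comap
      (rewriteIter t (n + 1) w)) ?_ hm
    rintro p q hpq a ha b hb
    cases p with
    | zero =>
      rw [tensorWeight_zero, Submodule.mem_one] at ha
      obtain ⟨r, rfl⟩ := ha
      rw [Algebra.algebraMap_eq_smul_one, ← TensorProduct.smul_tmul']
      refine Submodule.smul_mem _ _ ?_
      simp only [Submodule.mem_comap, rewriteIter, rewriteStep_one_tmul]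
      refine tmul_mem_kunneth_s4 (p := 0) (q := 1 + q) (by omega) ?_
        (mul_mem_tensorWeight (ι_mem_tensorWeight_one w) hb)
      rw [tensorWeight_zero]; exact Submodule.one_le.1 le_rfl
    | succ p =>
      refine tensorWeight_succ_le (S := ((kunneth 𝕜 (tensorWeight 𝕜 V) (tensorWeight 𝕜 W)
        (j + 1)).comap (rewriteIter t (n + 1) w)).comap
          ((TensorProduct.mk 𝕜 _ _).flip b)) ?_ ha
      intro v a ha
      have hab : a ⊗ₜ b ∈ kunneth 𝕜 (tensorWeight 𝕜 V) (tensorWeight 𝕜 W) (p + q) :=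
        tmul_mem_kunneth_s4 rfl ha hb
      simp only [Submodule.mem_comap, LinearMap.flip_apply, TensorProduct.mk_apply, rewriteIter]
      rw [← smul_eq_mul, ← TensorProduct.smul_tmul', rewriteStep_smul]
      refine kunneth_le (S := (kunneth 𝕜 (tensorWeight 𝕜 V) (tensorWeight 𝕜 W) (j + 1)).comap
        ((theta (rewriteIter t n)).flip (a ⊗ₜ b))) ?_ (ht w v)
      intro i k hik c hc d hd
      have := smul_mem_kunneth hc (lift_mem_kunneth ih hab hd)
      rw [show j + 1 = i + (k + (p + q)) by omega]
      simpa using this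

/-- The submodule of `T(V) ⊗ T(W)` of elements of degree at most `k` in `T(V)`. -/
def leftFilt (𝕜 V W : Type) [Field 𝕜] [AddCommGroup V] [Module 𝕜 V] [AddCommGroup W]
    [Module 𝕜 W] : ℕ → Submodule 𝕜 (TT 𝕜 V W)
  | 0 => LinearMap.range (TensorProduct.mk 𝕜 (TensorAlgebra 𝕜 V) (TensorAlgebra 𝕜 W) 1)
  | k + 1 => leftFilt 𝕜 V W 0 ⊔
      Submodule.span 𝕜 {x | ∃ (v : V), ∃ m ∈ leftFilt 𝕜 V W k, x = ι 𝕜 v • m}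

lemma one_tmul_mem_leftFilt (k : ℕ) (b : TensorAlgebra 𝕜 W) :
    (1 : TensorAlgebra 𝕜 V) ⊗ₜ b ∈ leftFilt 𝕜 V W k := by
  have h0 : (1 : TensorAlgebra 𝕜 V) ⊗ₜ b ∈ leftFilt 𝕜 V W 0 := by
    rw [leftFilt]; exact ⟨b, rfl⟩
  cases k with
  | zero => exact h0
  | succ k => rw [leftFilt]; exact Submodule.mem_sup_left h0

lemma ι_smul_mem_leftFilt {k : ℕ} {m : TT 𝕜 V W} (v : V) (hm : m ∈ leftFilt 𝕜 V W k) :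
    ι 𝕜 v • m ∈ leftFilt 𝕜 V W (k + 1) := by
  rw [leftFilt]; exact Submodule.mem_sup_right (Submodule.subset_span ⟨v, m, hm, rfl⟩)

lemma leftFilt_zero_le {S : Submodule 𝕜 (TT 𝕜 V W)}
    (h1 : ∀ b, (1 : TensorAlgebra 𝕜 V) ⊗ₜ b ∈ S) : leftFilt 𝕜 V W 0 ≤ S := by
  rw [leftFilt]; rintro _ ⟨b, rfl⟩; exact h1 b

lemma leftFilt_succ_le {k : ℕ} {S : Submodule 𝕜 (TT 𝕜 V W)}
    (h1 : ∀ b, (1 : TensorAlgebra 𝕜 V) ⊗ₜ b ∈ S)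
    (hι : ∀ v : V, ∀ m ∈ leftFilt 𝕜 V W k, ι 𝕜 v • m ∈ S) : leftFilt 𝕜 V W (k + 1) ≤ S := by
  rw [leftFilt]
  refine sup_le (leftFilt_zero_le h1) (Submodule.span_le.2 ?_)
  rintro _ ⟨v, m, hm, rfl⟩
  exact hι v m hm

lemma leftFilt_le_succ (k : ℕ) : leftFilt 𝕜 V W k ≤ leftFilt 𝕜 V W (k + 1) := by
  induction k with
  | zero => exact leftFilt_zero_le (one_tmul_mem_leftFilt 1)
  | succ k ih =>
    exact leftFilt_succ_le (one_tmul_mem_leftFilt _) fun v m hm => ι_smul_mem_leftFilt v (ih hm)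

lemma exists_mem_leftFilt (m : TT 𝕜 V W) : ∃ k, m ∈ leftFilt 𝕜 V W k := by
  have hmono : Monotone (leftFilt 𝕜 V W) := monotone_nat_of_le_succ leftFilt_le_succ
  have hdir : Directed (· ≤ ·) (leftFilt 𝕜 V W) := hmono.directed_le
  rw [← Submodule.mem_iSup_of_directed _ hdir]
  refine TT.mem_of_left (fun b => ?_) (fun v m hm => ?_) m
  · exact Submodule.mem_iSup_of_mem 0 (one_tmul_mem_leftFilt 0 b)
  · obtain ⟨k, hk⟩ := (Submodule.mem_iSup_of_directed _ hdir).1 hm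
    exact Submodule.mem_iSup_of_mem (k + 1) (ι_smul_mem_leftFilt v hk)

/-- The separability hypothesis on `t`, phrased as an elimination principle into submodules. -/
structure Separable (t : W ⊗[𝕜] V →ₗ[𝕜] TT 𝕜 V W) (W' W'' : Submodule 𝕜 W) : Prop where
  codisjoint : W' ⊔ W'' = ⊤
  left : ∀ w ∈ W', ∀ v, ∀ S : Submodule 𝕜 (TT 𝕜 V W), (∀ v, ∀ w ∈ W', ι 𝕜 v ⊗ₜ ι 𝕜 w ∈ S) →
    (∀ v v', (ι 𝕜 v * ι 𝕜 v') ⊗ₜ 1 ∈ S) → t (w ⊗ₜ v) ∈ S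
  right : ∀ w ∈ W'', ∀ v, ∀ S : Submodule 𝕜 (TT 𝕜 V W),
    (∀ v, ∀ w ∈ W'', ι 𝕜 v ⊗ₜ ι 𝕜 w ∈ S) →
    (∀ w, ∀ w' ∈ W'', 1 ⊗ₜ (ι 𝕜 w * ι 𝕜 w') ∈ S) → t (w ⊗ₜ v) ∈ S

namespace Separable

variable {t : W ⊗[𝕜] V →ₗ[𝕜] TT 𝕜 V W} {W' W'' : Submodule 𝕜 W}

lemma forall_mem (ht : Separable t W' W'') {S : Submodule 𝕜 W} (h' : ∀ w ∈ W', w ∈ S)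
    (h'' : ∀ w ∈ W'', w ∈ S) (w : W) : w ∈ S :=
  (sup_le h' h'' : W' ⊔ W'' ≤ S) (ht.codisjoint ▸ Submodule.mem_top)

lemma mem_kunneth (ht : Separable t W' W'') (w : W) (v : V) :
    t (w ⊗ₜ v) ∈ kunneth 𝕜 (tensorWeight 𝕜 V) (tensorWeight 𝕜 W) 2 := by
  refine ht.forall_mem (S := (kunneth 𝕜 (tensorWeight 𝕜 V) (tensorWeight 𝕜 W) 2).comap
    (t ∘ₗ (TensorProduct.mk 𝕜 W V).flip v)) (fun w hw => ?_) (fun w hw => ?_) w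
  · change t (w ⊗ₜ v) ∈ kunneth 𝕜 (tensorWeight 𝕜 V) (tensorWeight 𝕜 W) 2
    refine ht.left w hw v _ (fun v w _ => ?_) (fun v v' => ?_)
    · exact tmul_mem_kunneth_s4 (p := 1) (q := 1) rfl (ι_mem_tensorWeight_one v)
        (ι_mem_tensorWeight_one w)
    · refine tmul_mem_kunneth_s4 (p := 1 + 1) (q := 0) rfl (mul_mem_tensorWeight
        (ι_mem_tensorWeight_one v) (ι_mem_tensorWeight_one v')) ?_
      rw [tensorWeight_zero]; exact Submodule.one_le.1 le_rfl
  · change t (w ⊗ₜ v) ∈ kunneth 𝕜 (tensorWeight 𝕜 V) (tensorWeight 𝕜 W) 2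
    refine ht.right w hw v _ (fun v w _ => ?_) (fun w w' _ => ?_)
    · exact tmul_mem_kunneth_s4 (p := 1) (q := 1) rfl (ι_mem_tensorWeight_one v)
        (ι_mem_tensorWeight_one w)
    · refine tmul_mem_kunneth_s4 (p := 0) (q := 1 + 1) rfl ?_ (mul_mem_tensorWeight
        (ι_mem_tensorWeight_one w) (ι_mem_tensorWeight_one w'))
      rw [tensorWeight_zero]; exact Submodule.one_le.1 le_rfl

/-- Rewriting terminates. -/
lemma rewriteIter_eventuallyConst (ht : Separable t W' W'') (k : ℕ) :
    ∀ m ∈ leftFilt 𝕜 V W k,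
      (∀ w, (fun n => rewriteIter t n w m) ∈ eventuallyConst (leftFilt 𝕜 V W (k + 1))) ∧
      ∀ w ∈ W'', (fun n => rewriteIter t n w m) ∈ eventuallyConst (leftFilt 𝕜 V W k) := by
  have hseq (w : W) : ∃ f : TT 𝕜 V W →ₗ[𝕜] ℕ → TT 𝕜 V W,
      ∀ m, f m = fun n => rewriteIter t n w m :=
    ⟨LinearMap.pi fun n => rewriteIter t n w, fun m => rfl⟩
  have hseq' (m : TT 𝕜 V W) : ∃ f : W →ₗ[𝕜] ℕ → TT 𝕜 V W,
      ∀ w, f w = fun n => rewriteIter t n w m :=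
    ⟨LinearMap.pi fun n => (rewriteIter t n).flip m, fun m => rfl⟩
  choose f hf using hseq
  choose f' hf' using hseq'
  have hone (k : ℕ) (w : W) (b : TensorAlgebra 𝕜 W) :
      (fun n => rewriteIter t n w (1 ⊗ₜ b)) ∈ eventuallyConst (leftFilt 𝕜 V W k) :=
    eventuallyConst_of_succ ⟨1 ⊗ₜ (ι 𝕜 w * b), one_tmul_mem_leftFilt _ _,
      by simp [rewriteIter]⟩
  induction k with
  | zero =>
    intro m hm
    have key (w : W) (k : ℕ) :
        (fun n => rewriteIter t n w m) ∈ eventuallyConst (leftFilt 𝕜 V W k) := by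
      rw [← hf]
      refine leftFilt_zero_le (S := (eventuallyConst _).comap (f w)) (fun b => ?_) hm
      rw [Submodule.mem_comap, hf]
      exact hone _ _ _
    exact ⟨fun w => key w _, fun w _ => key w _⟩
  | succ k ih =>
    have key (w : W) (hw : w ∈ W'') : ∀ m ∈ leftFilt 𝕜 V W (k + 1),
        (fun n => rewriteIter t n w m) ∈ eventuallyConst (leftFilt 𝕜 V W (k + 1)) := by
      intro m hm
      rw [← hf]
      refine leftFilt_succ_le (S := (eventuallyConst _).comap (f w)) (fun b => ?_)
        (fun v m hm => ?_) hm
      · rw [Submodule.mem_comap, hf]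
        exact hone _ _ _
      · rw [Submodule.mem_comap, hf]
        apply eventuallyConst_of_succ
        simp only [rewriteIter, rewriteStep_smul]
        refine ht.right w hw v ((eventuallyConst _).comap
          (LinearMap.pi fun n => (theta (rewriteIter t n)).flip m)) (fun v w hw => ?_)
          (fun w w' hw' => ?_)
        · obtain ⟨y, hy, hev⟩ := (ih m hm).2 w hw
          refine ⟨ι 𝕜 v • y, ι_smul_mem_leftFilt v hy, ?_⟩
          filter_upwards [hev] with n hn
          simp [hn]
        · obtain ⟨y, hy, hev⟩ := (ih m hm).2 w' hw'
          obtain ⟨z, hz, hev'⟩ := (ih y hy).1 w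
          refine ⟨z, hz, ?_⟩
          filter_upwards [hev, hev'] with n hn hn'
          simp [hn, hn']
    intro m hm
    refine ⟨fun w => ?_, fun w hw => key w hw m hm⟩
    rw [← hf']
    refine ht.forall_mem (S := (eventuallyConst _).comap (f' m)) (fun w hw => ?_)
      (fun w hw => ?_) w
    · rw [Submodule.mem_comap, hf', ← hf]
      refine leftFilt_succ_le (S := (eventuallyConst _).comap (f w)) (fun b => ?_)
        (fun v m hm => ?_) hm
      · rw [Submodule.mem_comap, hf]
        exact hone _ _ _
      · rw [Submodule.mem_comap, hf]
        apply eventuallyConst_of_succ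
        simp only [rewriteIter, rewriteStep_smul]
        refine ht.left w hw v ((eventuallyConst _).comap
          (LinearMap.pi fun n => (theta (rewriteIter t n)).flip m)) (fun v w hw => ?_)
          (fun v v' => ?_)
        · obtain ⟨y, hy, hev⟩ := (ih m hm).1 w
          refine ⟨ι 𝕜 v • y, ι_smul_mem_leftFilt v hy, ?_⟩
          filter_upwards [hev] with n hn
          simp [hn]
        · refine ⟨ι 𝕜 v • ι 𝕜 v' • m,
            ι_smul_mem_leftFilt v (ι_smul_mem_leftFilt v' hm), ?_⟩
          simp [mul_smul]
    · rw [Submodule.mem_comap, hf']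
      exact eventuallyConst_mono (leftFilt_le_succ _) (key w hw m hm)

/-- The limit of the iterated rewriting. -/
lemma exists_action (ht : Separable t W' W'') :
    ∃ P : W →ₗ[𝕜] Module.End 𝕜 (TT 𝕜 V W),
      ∀ w m, ∀ᶠ n in atTop, rewriteIter t n w m = P w m := by
  obtain ⟨g, hg⟩ := exists_limit_of_eventuallyConst
    (fun n => TensorProduct.lift (rewriteIter t n)) (by
      intro x
      induction x using TensorProduct.induction_on with
      | zero => exact ⟨0, by simp⟩
      | add x y hx hy =>
        obtain ⟨a, ha⟩ := hx
        obtain ⟨b, hb⟩ := hy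
        refine ⟨a + b, ?_⟩
        filter_upwards [ha, hb] with n h1 h2
        rw [map_add, h1, h2]
      | tmul w m =>
        obtain ⟨k, hk⟩ := exists_mem_leftFilt m
        obtain ⟨y, -, hy⟩ := (ht.rewriteIter_eventuallyConst k m hk).1 w
        exact ⟨y, hy⟩)
  exact ⟨TensorProduct.curry g, fun w m => hg (w ⊗ₜ m)⟩

end Separable

lemma lift_eventually {t : W ⊗[𝕜] V →ₗ[𝕜] TT 𝕜 V W} {P : W →ₗ[𝕜] Module.End 𝕜 (TT 𝕜 V W)}
    (hP : ∀ w m, ∀ᶠ n in atTop, rewriteIter t n w m = P w m) (b : TensorAlgebra 𝕜 W) :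
    ∀ m, ∀ᶠ n in atTop,
      TensorAlgebra.lift 𝕜 (rewriteIter t n) b m = TensorAlgebra.lift 𝕜 P b m := by
  induction b using TensorAlgebra.induction with
  | algebraMap r => intro m; simp
  | ι w => intro m; simpa using hP w m
  | mul a b ha hb =>
    intro m
    filter_upwards [hb m, ha (TensorAlgebra.lift 𝕜 P b m)] with n h1 h2
    simp [h1, h2]
  | add a b ha hb =>
    intro m
    filter_upwards [ha m, hb m] with n h1 h2
    simp [h1, h2]

lemma theta_eventually {t : W ⊗[𝕜] V →ₗ[𝕜] TT 𝕜 V W} {P : W →ₗ[𝕜] Module.End 𝕜 (TT 𝕜 V W)}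
    (hP : ∀ w m, ∀ᶠ n in atTop, rewriteIter t n w m = P w m) (x m : TT 𝕜 V W) :
    ∀ᶠ n in atTop, theta (rewriteIter t n) x m = theta P x m := by
  induction x using TensorProduct.induction_on with
  | zero => simp
  | add x y hx hy =>
    filter_upwards [hx, hy] with n h1 h2
    simp [h1, h2]
  | tmul a b =>
    filter_upwards [lift_eventually hP b m] with n hn
    simp [hn]

/-- The left action of `W` on `T(V) ⊗ T(W)` determined by the relations `wv = t(w ⊗ v)`. -/
structure IsAction (t : W ⊗[𝕜] V →ₗ[𝕜] TT 𝕜 V W)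
    (P : W →ₗ[𝕜] Module.End 𝕜 (TT 𝕜 V W)) : Prop where
  one_tmul : ∀ w b, P w (1 ⊗ₜ b) = 1 ⊗ₜ (ι 𝕜 w * b)
  smul : ∀ w v m, P w (ι 𝕜 v • m) = theta P (t (w ⊗ₜ v)) m
  commute : ∀ b w m, P w (rightMul b m) = rightMul b (P w m)
  mem_kunneth : ∀ w j, ∀ m ∈ kunneth 𝕜 (tensorWeight 𝕜 V) (tensorWeight 𝕜 W) j,
    P w m ∈ kunneth 𝕜 (tensorWeight 𝕜 V) (tensorWeight 𝕜 W) (j + 1)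
  theta_apply : ∀ w x m, theta P (P w x) m = P w (theta P x m)

lemma Separable.exists_isAction {t : W ⊗[𝕜] V →ₗ[𝕜] TT 𝕜 V W} {W' W'' : Submodule 𝕜 W}
    (ht : Separable t W' W'') : ∃ P, IsAction t P := by
  obtain ⟨P, hP⟩ := ht.exists_action
  have hone : ∀ w b, P w (1 ⊗ₜ b) = 1 ⊗ₜ (ι 𝕜 w * b) := by
    intro w b
    obtain ⟨n, hn⟩ := ((tendsto_add_atTop_nat 1).eventually (hP w (1 ⊗ₜ b))).exists
    rw [← hn]; simp [rewriteIter]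
  have hsmul : ∀ w v m, P w (ι 𝕜 v • m) = theta P (t (w ⊗ₜ v)) m := by
    intro w v m
    obtain ⟨n, hn, hn'⟩ := (((tendsto_add_atTop_nat 1).eventually (hP w (ι 𝕜 v • m))).and
      (theta_eventually hP (t (w ⊗ₜ v)) m)).exists
    rw [← hn, ← hn']; simp [rewriteIter]
  have hfilt : ∀ k, ∀ m ∈ leftFilt 𝕜 V W k, ∀ w ∈ W'', P w m ∈ leftFilt 𝕜 V W k := by
    intro k m hm w hw
    obtain ⟨y, hy, hev⟩ := (ht.rewriteIter_eventuallyConst k m hm).2 w hw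
    obtain ⟨n, h1, h2⟩ := (hev.and (hP w m)).exists
    have h3 : P w m = y := h2.symm.trans h1
    rwa [h3]
  refine ⟨P, hone, hsmul, fun b w m => ?_, fun w j m hm => ?_, fun w x m => ?_⟩
  · obtain ⟨n, h1, h2⟩ := ((hP w (rightMul b m)).and (hP w m)).exists
    rw [← h1, ← h2, rewriteIter_commute]
  · obtain ⟨n, h⟩ := (hP w m).exists
    rw [← h]
    exact rewriteIter_mem_kunneth ht.mem_kunneth n w j m hm
  · obtain ⟨k, hk⟩ := exists_mem_leftFilt x
    induction k generalizing w x with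
    | zero =>
      refine leftFilt_zero_le (S := LinearMap.eqLocus ((theta P).flip m ∘ₗ P w)
        (P w ∘ₗ (theta P).flip m)) (fun b => ?_) hk
      simp [hone]
    | succ k ih =>
      refine leftFilt_succ_le (S := LinearMap.eqLocus ((theta P).flip m ∘ₗ P w)
        (P w ∘ₗ (theta P).flip m)) (fun b => ?_) (fun v x hx => ?_) hk
      · simp [hone]
      · simp only [LinearMap.mem_eqLocus, LinearMap.comp_apply, LinearMap.flip_apply,
          theta_smul, hsmul]
        refine ht.forall_mem (S := LinearMap.eqLocus
          ((theta P).flip m ∘ₗ (theta P).flip x ∘ₗ t ∘ₗ (TensorProduct.mk 𝕜 W V).flip v)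
          ((theta P).flip (theta P x m) ∘ₗ t ∘ₗ (TensorProduct.mk 𝕜 W V).flip v))
          (fun w hw => ?_) (fun w hw => ?_) w
        · refine ht.left w hw v (LinearMap.eqLocus ((theta P).flip m ∘ₗ (theta P).flip x)
            ((theta P).flip (theta P x m))) (fun v w hw => ?_) (fun v v' => ?_)
          · simp [theta_smul, ih w x hx]
          · simp [theta_smul]
        · refine ht.right w hw v (LinearMap.eqLocus ((theta P).flip m ∘ₗ (theta P).flip x)
            ((theta P).flip (theta P x m))) (fun v w hw => ?_) (fun w w' hw => ?_)
          · simp [theta_smul, ih w x hx]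
          · simp [ih w _ (hfilt k x hx w' hw), ih w' x hx]

/-- The map `b ⊗ a ↦ ρ(b)(a ⊗ 1)`, where `ρ` is the action of `T(W)` extending `P`. -/
def twist (P : W →ₗ[𝕜] Module.End 𝕜 (TT 𝕜 V W)) :
    TensorAlgebra 𝕜 W ⊗[𝕜] TensorAlgebra 𝕜 V →ₗ[𝕜] TT 𝕜 V W :=
  TensorProduct.lift ((LinearMap.lcomp 𝕜 _ ((TensorProduct.mk 𝕜 _ _).flip 1)) ∘ₗ
    (TensorAlgebra.lift 𝕜 P).toLinearMap)

@[simp] lemma twist_tmul (P : W →ₗ[𝕜] Module.End 𝕜 (TT 𝕜 V W)) (b : TensorAlgebra 𝕜 W)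
    (a : TensorAlgebra 𝕜 V) :
    twist P (b ⊗ₜ a) = TensorAlgebra.lift 𝕜 P b (a ⊗ₜ 1) := rfl

namespace IsAction

variable {t : W ⊗[𝕜] V →ₗ[𝕜] TT 𝕜 V W} {P : W →ₗ[𝕜] Module.End 𝕜 (TT 𝕜 V W)}

lemma lift_one_tmul (h : IsAction t P) (b : TensorAlgebra 𝕜 W) :
    ∀ b', TensorAlgebra.lift 𝕜 P b (1 ⊗ₜ b') = 1 ⊗ₜ (b * b') := by
  induction b using TensorAlgebra.induction with
  | algebraMap r => intro b'; simp [← Algebra.smul_def]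
  | ι w => intro b'; simp [h.one_tmul]
  | mul a b ha hb => intro b'; simp [ha, hb, mul_assoc]
  | add a b ha hb => intro b'; simp [ha, hb, add_mul, TensorProduct.tmul_add]

lemma theta_apply_one (h : IsAction t P) (x : TT 𝕜 V W) : theta P x (1 ⊗ₜ 1) = x := by
  induction x using TensorProduct.induction_on with
  | zero => simp
  | add x y hx hy => rw [map_add, LinearMap.add_apply, hx, hy]
  | tmul a b => simp [h.lift_one_tmul, TensorProduct.smul_tmul']

lemma theta_lift (h : IsAction t P) (b : TensorAlgebra 𝕜 W) :
    ∀ x m, theta P (TensorAlgebra.lift 𝕜 P b x) m = TensorAlgebra.lift 𝕜 P b (theta P x m) := by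
  induction b using TensorAlgebra.induction with
  | algebraMap r => intro x m; simp
  | ι w => intro x m; simp [h.theta_apply]
  | mul a b ha hb => intro x m; simp [ha, hb]
  | add a b ha hb => intro x m; simp [ha, hb]

lemma mulTau_twist (h : IsAction t P) (x y : TT 𝕜 V W) :
    mulTau 𝕜 _ _ (twist P) (x ⊗ₜ y) = theta P x y := by
  induction x using TensorProduct.induction_on with
  | zero => simp
  | add x x' hx hx' => simp only [TensorProduct.add_tmul, map_add, hx, hx', LinearMap.add_apply]
  | tmul a b =>
    induction y using TensorProduct.induction_on with
    | zero => simp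
    | add y y' hy hy' => simp only [TensorProduct.tmul_add, map_add, hy, hy']
    | tmul a' b' =>
      have hr : a' ⊗ₜ b' = rightMul b' (a' ⊗ₜ[𝕜] 1) := by simp
      rw [theta_tmul, hr, lift_commute (h.commute b') b, ← twist_tmul, ← hr]
      simp only [mulTau, LinearMap.comp_apply, LinearEquiv.coe_coe, TensorProduct.assoc_tmul,
        LinearMap.lTensor_tmul, TensorProduct.assoc_symm_tmul, LinearMap.rTensor_tmul]
      generalize twist P (b ⊗ₜ a') = z
      induction z using TensorProduct.induction_on with
      | zero => simp
      | add z z' hz hz' =>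
        simp only [TensorProduct.add_tmul, TensorProduct.tmul_add, map_add, smul_add, hz, hz']
      | tmul c d => simp [TensorProduct.smul_tmul']

lemma twistRHS_twist (h : IsAction t P) (b b' : TensorAlgebra 𝕜 W) (a a' : TensorAlgebra 𝕜 V) :
    twistRHS 𝕜 _ _ (twist P) ((b ⊗ₜ b') ⊗ₜ (a ⊗ₜ a')) =
      TensorAlgebra.lift 𝕜 P b (theta P (twist P (b' ⊗ₜ a)) (a' ⊗ₜ 1)) := by
  have hmul : twistRHS 𝕜 _ _ (twist P) = mulTau 𝕜 _ _ (twist P)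
    ∘ₗ TensorProduct.map (twist P) (twist P)
    ∘ₗ (TensorProduct.assoc 𝕜 _ _ _).symm.toLinearMap
    ∘ₗ LinearMap.lTensor _ (TensorProduct.assoc 𝕜 _ _ _).toLinearMap
    ∘ₗ LinearMap.lTensor _ (LinearMap.rTensor _ (twist P))
    ∘ₗ LinearMap.lTensor _ (TensorProduct.assoc 𝕜 _ _ _).symm.toLinearMap
    ∘ₗ (TensorProduct.assoc 𝕜 _ _ _).toLinearMap := rfl
  rw [hmul]
  simp only [LinearMap.comp_apply, LinearEquiv.coe_coe, TensorProduct.assoc_tmul,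
    LinearMap.lTensor_tmul, TensorProduct.assoc_symm_tmul, LinearMap.rTensor_tmul]
  generalize twist P (b' ⊗ₜ a) = z
  induction z using TensorProduct.induction_on with
  | zero => simp
  | add z z' hz hz' =>
    simp only [TensorProduct.add_tmul, TensorProduct.tmul_add, map_add, LinearMap.add_apply,
      hz, hz']
  | tmul c d =>
    simp only [TensorProduct.assoc_tmul, TensorProduct.assoc_symm_tmul, TensorProduct.map_tmul,
      h.mulTau_twist, twist_tmul, h.theta_lift, theta_tmul]
    simp

lemma isTwisting (h : IsAction t P) : IsTwisting 𝕜 _ _ (twist P) := by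
  refine ⟨fun a => by simp, fun b => by simp [h.lift_one_tmul], ?_⟩
  apply TensorProduct.ext_fourfold'
  intro b b' a a'
  rw [h.twistRHS_twist, twist_tmul, h.theta_lift]
  simp [twistLHS, TensorProduct.smul_tmul']

lemma isGradedMapBA (h : IsAction t P) :
    IsGradedMapBA 𝕜 _ _ (tensorWeight 𝕜 V) (tensorWeight 𝕜 W) (twist P) := by
  intro n
  rw [Submodule.map_le_iff_le_comap]
  refine kunneth_le fun q p hqp b hb a ha => ?_
  have ha1 : a ⊗ₜ 1 ∈ kunneth 𝕜 (tensorWeight 𝕜 V) (tensorWeight 𝕜 W) p := by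
    refine tmul_mem_kunneth_s4 (add_zero p) ha ?_
    rw [tensorWeight_zero]; exact Submodule.one_le.1 le_rfl
  rw [← hqp]
  exact lift_mem_kunneth h.mem_kunneth ha1 hb

lemma twist_ι_tmul_ι (h : IsAction t P) (w : W) (v : V) :
    twist P (ι 𝕜 w ⊗ₜ ι 𝕜 v) = t (w ⊗ₜ v) := by
  have hv : ι 𝕜 v ⊗ₜ 1 = ι 𝕜 v • (1 ⊗ₜ 1 : TT 𝕜 V W) := by simp [TensorProduct.smul_tmul']
  rw [twist_tmul, hv, lift_ι_apply, h.smul, h.theta_apply_one]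

end IsAction

end TensorAlgebras

/-- Theorem 3.5 (`extendSepTau`).  Let `A = T(A₁)` and `B = T(B₁)` be tensor algebras on
finite-dimensional spaces, with `B₁ = B₁' ⊕ B₁''`.  If `t : B₁ ⊗ A₁ → A ⊗ B` satisfies
`t(B₁' ⊗ A₁) ⊆ A₁ ⊗ B₁' ⊕ A₂ ⊗ B₀` and `t(B₁'' ⊗ A₁) ⊆ A₁ ⊗ B₁'' ⊕ A₀ ⊗ μ_B(B₁ ⊗ B₁'')`,
then there exists a graded twisting map `τ : B ⊗ A → A ⊗ B` restricting to `t` on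
`B₁ ⊗ A₁`. -/
theorem stmt4 (𝕜 : Type) [Field 𝕜] (V W : Type)
    [AddCommGroup V] [Module 𝕜 V] [AddCommGroup W] [Module 𝕜 W]
    [FiniteDimensional 𝕜 V] [FiniteDimensional 𝕜 W]
    (W' W'' : Submodule 𝕜 W) (hcompl : IsCompl W' W'')
    (t : W ⊗[𝕜] V →ₗ[𝕜] (TensorAlgebra 𝕜 V) ⊗[𝕜] (TensorAlgebra 𝕜 W))
    (h1 : Submodule.map t (subTmul 𝕜 W' (⊤ : Submodule 𝕜 V)) ≤
      subTmul 𝕜 (tensorWeight 𝕜 V 1) (Submodule.map (TensorAlgebra.ι 𝕜) W') ⊔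
        subTmul 𝕜 (tensorWeight 𝕜 V 2) (tensorWeight 𝕜 W 0))
    (h2 : Submodule.map t (subTmul 𝕜 W'' (⊤ : Submodule 𝕜 V)) ≤
      subTmul 𝕜 (tensorWeight 𝕜 V 1) (Submodule.map (TensorAlgebra.ι 𝕜) W'') ⊔
        subTmul 𝕜 (tensorWeight 𝕜 V 0)
          (tensorWeight 𝕜 W 1 * Submodule.map (TensorAlgebra.ι 𝕜) W'')) :
    ∃ τ : (TensorAlgebra 𝕜 W) ⊗[𝕜] (TensorAlgebra 𝕜 V) →ₗ[𝕜]
        (TensorAlgebra 𝕜 V) ⊗[𝕜] (TensorAlgebra 𝕜 W),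
      IsGradedTwisting 𝕜 (TensorAlgebra 𝕜 V) (TensorAlgebra 𝕜 W)
        (tensorWeight 𝕜 V) (tensorWeight 𝕜 W) τ ∧
      ∀ (w : W) (v : V),
        τ ((TensorAlgebra.ι 𝕜 w) ⊗ₜ[𝕜] (TensorAlgebra.ι 𝕜 v)) = t (w ⊗ₜ[𝕜] v) := by
  have ht : Separable t W' W'' := by
    refine ⟨hcompl.sup_eq_top, fun w hw v S hS hS' => ?_, fun w hw v S hS hS' => ?_⟩
    · refine (h1.trans (sup_le (subTmul_le ?_) (subTmul_le ?_)))
        ⟨_, tmul_mem_subTmul hw Submodule.mem_top, rfl⟩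
      · rw [tensorWeight_one]
        rintro _ ⟨v, rfl⟩ _ ⟨w, hw, rfl⟩
        exact hS v w hw
      · intro a ha b hb
        rw [tensorWeight_zero, Submodule.mem_one] at hb
        obtain ⟨r, rfl⟩ := hb
        rw [Algebra.algebraMap_eq_smul_one, TensorProduct.tmul_smul]
        refine S.smul_mem r (tensorWeight_succ_le (p := 1)
          (S := S.comap ((TensorProduct.mk 𝕜 _ _).flip 1)) ?_ ha)
        rw [tensorWeight_one]
        rintro v _ ⟨v', rfl⟩
        exact hS' v v'
    · refine (h2.trans (sup_le (subTmul_le ?_) (subTmul_le ?_)))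
        ⟨_, tmul_mem_subTmul hw Submodule.mem_top, rfl⟩
      · rw [tensorWeight_one]
        rintro _ ⟨v, rfl⟩ _ ⟨w, hw, rfl⟩
        exact hS v w hw
      · intro a ha b hb
        rw [tensorWeight_zero, Submodule.mem_one] at ha
        obtain ⟨r, rfl⟩ := ha
        rw [Algebra.algebraMap_eq_smul_one, ← TensorProduct.smul_tmul']
        refine S.smul_mem r ?_
        revert b
        change _ ≤ S.comap (TensorProduct.mk 𝕜 _ _ 1)
        rw [Submodule.mul_le, tensorWeight_one]
        rintro _ ⟨w, rfl⟩ _ ⟨w', hw', rfl⟩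
        exact hS' w w' hw'
  obtain ⟨P, hP⟩ := ht.exists_isAction
  exact ⟨twist P, ⟨hP.isTwisting, hP.isGradedMapBA⟩, hP.twist_ι_tmul_ι⟩

end TTP
end
end
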